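/- arXiv:2312.15335 — 2 statements merged into one kernel-verified Lean document; each statement's English description precedes it below -/
import Mathlib

section
/- Let U = [−L/2, L/2]^d be the flat torus, D ∈ W^{2,∞}(U), κ > 0, and let ρ = ρ(t,x) be a classical solution of ∂t ρ = κ div_x(ρ (∇_x D ⋆ ρ)) + Δ_x ρ with ρ ∈ C¹((0,∞); C²(U)) and ρ(t,·) a strictly positive probability density on U for each t > 0. Then for every t > 0 the relative entropy is differentiable in time and satisfies the dissipation identity d/dt H(ρ(t)|ρ∞) = − ∫_U |∇_x log ρ(t,x)|² ρ(t,x) dx + κ ∫_U ρ(t,x) (Δ_x D ⋆ ρ(t,·))(x) dx. -/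
open MeasureTheory Real

noncomputable section

/-- The fundamental domain `[-L/2, L/2]^d` of the flat torus of side length `L`. -/
def box (L : ℝ) (d : ℕ) : Set (Fin d → ℝ) :=
  Set.Icc (fun _ => -(L / 2)) (fun _ => L / 2)

/-- Partial derivative in the `i`-th coordinate direction. -/
def pd {d : ℕ} (i : Fin d) (f : (Fin d → ℝ) → ℝ) (x : Fin d → ℝ) : ℝ :=
  fderiv ℝ f x (Pi.single i 1)

/-- Laplacian. -/
def lap {d : ℕ} (f : (Fin d → ℝ) → ℝ) (x : Fin d → ℝ) : ℝ :=
  ∑ i, pd i (pd i f) x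

/-- Divergence of a vector field. -/
def divg {d : ℕ} (F : (Fin d → ℝ) → Fin d → ℝ) (x : Fin d → ℝ) : ℝ :=
  ∑ i, pd i (fun y => F y i) x

/-- `L`-periodicity in each coordinate (i.e. `f` is a function on the flat torus). -/
def Per {d : ℕ} (L : ℝ) (f : (Fin d → ℝ) → ℝ) : Prop :=
  ∀ (x : Fin d → ℝ) (i : Fin d), f (x + L • (Pi.single i 1 : Fin d → ℝ)) = f x

/-- Convolution on the torus: `(f ⋆ g)(x) = ∫_U f(x-y) g(y) dy`. -/
def conv {d : ℕ} (L : ℝ) (f g : (Fin d → ℝ) → ℝ) (x : Fin d → ℝ) : ℝ :=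
  ∫ y in box L d, f (x - y) * g y

/-- Relative entropy with respect to the splay state `ρ∞ = 1 / L^d`. -/
def relEnt {d : ℕ} (L : ℝ) (ρ : (Fin d → ℝ) → ℝ) : ℝ :=
  ∫ x in box L d, ρ x * Real.log (ρ x * L ^ d)

section basics
open Filter Topology
variable {d : ℕ} {L : ℝ}

theorem box_compact : IsCompact (box L d) := isCompact_Icc

theorem box_meas : MeasurableSet (box L d) := measurableSet_Icc

theorem cont_int {f : (Fin d → ℝ) → ℝ} (hf : Continuous f) : IntegrableOn f (box L d) :=
  hf.continuousOn.integrableOn_compact box_compact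

theorem bint_add {f g : (Fin d → ℝ) → ℝ} (hf : Continuous f) (hg : Continuous g) :
    ∫ x in box L d, f x + g x = (∫ x in box L d, f x) + ∫ x in box L d, g x :=
  integral_add (cont_int hf) (cont_int hg)

theorem bint_sub {f g : (Fin d → ℝ) → ℝ} (hf : Continuous f) (hg : Continuous g) :
    ∫ x in box L d, f x - g x = (∫ x in box L d, f x) - ∫ x in box L d, g x :=
  integral_sub (cont_int hf) (cont_int hg)

theorem bint_mono {f g : (Fin d → ℝ) → ℝ} (hf : Continuous f) (hg : Continuous g)
    (h : ∀ x, f x ≤ g x) : ∫ x in box L d, f x ≤ ∫ x in box L d, g x :=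
  integral_mono (cont_int hf) (cont_int hg) h

theorem bint_sum {f : Fin d → (Fin d → ℝ) → ℝ} (hf : ∀ i, Continuous (f i)) :
    ∫ x in box L d, ∑ i, f i x = ∑ i, ∫ x in box L d, f i x :=
  integral_finsetSum _ fun i _ => cont_int (hf i)

instance box_fin : IsFiniteMeasure (volume.restrict (box L d)) :=
  ⟨by simpa using (box_compact (L := L) (d := d)).measure_lt_top⟩

theorem pd_cont {f : (Fin d → ℝ) → ℝ} (hf : ContDiff ℝ 1 f) (i : Fin d) : Continuous (pd i f) :=
  (hf.continuous_fderiv one_ne_zero).clm_apply continuous_const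

theorem pd_C1 {f : (Fin d → ℝ) → ℝ} (hf : ContDiff ℝ 2 f) (i : Fin d) :
    ContDiff ℝ 1 (pd i f) :=
  (hf.fderiv_right (m := 1) (by norm_num)).clm_apply contDiff_const

theorem pd_mul {f g : (Fin d → ℝ) → ℝ} (hf : ContDiff ℝ 1 f) (hg : ContDiff ℝ 1 g) (i : Fin d)
    (x : Fin d → ℝ) : pd i (fun y => f y * g y) x = f x * pd i g x + pd i f x * g x := by
  have h1 := (hf.differentiable one_ne_zero x)
  have h2 := (hg.differentiable one_ne_zero x)
  unfold pd
  rw [fderiv_fun_mul h1 h2]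
  simp [mul_comm]

theorem pd_sub {f g : (Fin d → ℝ) → ℝ} (hf : ContDiff ℝ 1 f) (hg : ContDiff ℝ 1 g) (i : Fin d)
    (x : Fin d → ℝ) : pd i (fun y => f y - g y) x = pd i f x - pd i g x := by
  have h1 := (hf.differentiable one_ne_zero x)
  have h2 := (hg.differentiable one_ne_zero x)
  unfold pd
  rw [fderiv_fun_sub h1 h2]
  simp

theorem pd_comp {f : (Fin d → ℝ) → ℝ} {b : ℝ → ℝ} {b' : ℝ} (hf : ContDiff ℝ 1 f) (i : Fin d)
    (x : Fin d → ℝ) (hb : HasDerivAt b b' (f x)) :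
    pd i (fun y => b (f y)) x = b' * pd i f x := by
  have h1 := (hf.differentiable one_ne_zero x).hasFDerivAt
  have := hb.comp_hasFDerivAt x h1
  unfold pd
  rw [show (fun y => b (f y)) = b ∘ f from rfl, this.fderiv]
  simp

theorem Per.mul {f g : (Fin d → ℝ) → ℝ} (hf : Per L f) (hg : Per L g) :
    Per L (fun y => f y * g y) := fun x i => by simp [hf x i, hg x i]

theorem Per.sub {f g : (Fin d → ℝ) → ℝ} (hf : Per L f) (hg : Per L g) :
    Per L (fun y => f y - g y) := fun x i => by simp [hf x i, hg x i]

theorem Per.comp {f : (Fin d → ℝ) → ℝ} (hf : Per L f) (b : ℝ → ℝ) :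
    Per L (fun y => b (f y)) := fun x i => by simp [hf x i]

theorem Per.pd {f : (Fin d → ℝ) → ℝ} (hf : Per L f) (i : Fin d) : Per L (pd i f) := by
  intro x j
  unfold _root_.pd
  rw [← fderiv_comp_add_right]
  congr 2
  funext y
  exact hf y j

theorem Per.conv {k f : (Fin d → ℝ) → ℝ} (hk : Per L k) : Per L (conv L k f) := by
  intro x j
  unfold _root_.conv
  congr 1
  funext y
  rw [show x + L • (Pi.single j 1 : Fin d → ℝ) - y = (x - y) + L • (Pi.single j 1 : Fin d → ℝ) by
    abel, hk]

theorem Per.nat {f : (Fin d → ℝ) → ℝ} (hf : Per L f) (x : Fin d → ℝ) (i : Fin d) (n : ℕ) :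
    f (x + (n * L) • (Pi.single i 1 : Fin d → ℝ)) = f x := by
  induction n with
  | zero => simp
  | succ n ih =>
    rw [← ih, ← hf (x + (n * L) • (Pi.single i 1 : Fin d → ℝ)) i]
    congr 1
    push_cast
    module

theorem Per.int {f : (Fin d → ℝ) → ℝ} (hf : Per L f) (x : Fin d → ℝ) (i : Fin d) (n : ℤ) :
    f (x + (n * L) • (Pi.single i 1 : Fin d → ℝ)) = f x := by
  obtain ⟨m, rfl | rfl⟩ := n.eq_nat_or_neg
  · simpa using hf.nat x i m
  · rw [← hf.nat _ i m]
    congr 1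
    push_cast
    module

theorem Per.intsum {f : (Fin d → ℝ) → ℝ} (hf : Per L f) (x : Fin d → ℝ) (n : Fin d → ℤ)
    (s : Finset (Fin d)) :
    f (x + ∑ i ∈ s, (n i * L) • (Pi.single i 1 : Fin d → ℝ)) = f x := by
  classical
  induction s using Finset.induction_on with
  | empty => simp
  | insert a s ha ih =>
    rw [Finset.sum_insert ha, ← ih,
      ← hf.int (x + ∑ i ∈ s, (n i * L) • (Pi.single i 1 : Fin d → ℝ)) a (n a)]
    congr 1
    abel

theorem Per.to_box {f : (Fin d → ℝ) → ℝ} (hL : 0 < L) (hf : Per L f) (x : Fin d → ℝ) :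
    ∃ y ∈ box L d, f y = f x := by
  let n : Fin d → ℤ := fun i => - ⌊x i / L + 1 / 2⌋
  refine ⟨x + ∑ i, (n i * L) • (Pi.single i 1 : Fin d → ℝ), ?_, hf.intsum x n _⟩
  have key : ∀ j, (x + ∑ i, (n i * L) • (Pi.single i 1 : Fin d → ℝ)) j = x j + n j * L := by
    intro j
    simp [Finset.sum_apply, Pi.single_apply]
  unfold box
  rw [Set.mem_Icc, Pi.le_def, Pi.le_def]
  have h0 : ∀ j, x j = (x j / L) * L := fun j => by field_simp
  refine ⟨fun j => ?_, fun j => ?_⟩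
  · rw [key, h0 j]
    have := Int.floor_le (x j / L + 1 / 2)
    simp only [n]; push_cast
    nlinarith
  · rw [key, h0 j]
    have := (Int.lt_floor_add_one (x j / L + 1 / 2)).le
    simp only [n]; push_cast
    nlinarith

theorem Per.bdd {f : (Fin d → ℝ) → ℝ} (hL : 0 < L) (hf : Per L f) (hc : Continuous f) :
    ∃ C, 0 ≤ C ∧ ∀ x, |f x| ≤ C := by
  obtain ⟨C, hC⟩ := (box_compact (L := L) (d := d)).exists_bound_of_continuousOn hc.continuousOn
  refine ⟨max C 0, le_max_right _ _, fun x => ?_⟩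
  obtain ⟨y, hy, e⟩ := hf.to_box hL x
  rw [← e]
  exact (hC y hy).trans (le_max_left _ _)

theorem int_pd_zero {f : (Fin d → ℝ) → ℝ} (hL : 0 < L) (hf : Per L f) (hc : ContDiff ℝ 1 f)
    (i : Fin d) : ∫ x in box L d, pd i f x = 0 := by
  cases d with
  | zero => exact i.elim0
  | succ n =>
    have h := integral_divergence_of_hasFDerivAt_off_countable' (n := n) (E := ℝ)
      (fun _ => -(L / 2)) (fun _ => L / 2) (by intro j; simp; linarith)
      (fun j x => if j = i then f x else 0)
      (fun j x => if j = i then fderiv ℝ f x else 0) ∅ Set.countable_empty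
      (fun j => by
        by_cases h : j = i
        · simp only [h, if_true]; exact hc.continuous.continuousOn
        · simp only [h, if_false]; exact continuousOn_const)
      (fun x _ j => by
        by_cases h : j = i
        · simp only [h, if_true]; exact (hc.differentiable one_ne_zero x).hasFDerivAt
        · simp only [h, if_false]; exact hasFDerivAt_const _ _)
      (by
        have : (fun x => ∑ j, (if j = i then fderiv ℝ f x else 0) (Pi.single j 1)) = pd i f := by
          funext x
          rw [Finset.sum_eq_single i]
          · simp [pd]
          · intro b _ hb; simp [hb]
          · simp
        rw [this]
        exact (pd_cont hc i).continuousOn.integrableOn_compact isCompact_Icc)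
    have e : (fun x => ∑ j, (if j = i then fderiv ℝ f x else 0) (Pi.single j 1)) = pd i f := by
      funext x
      rw [Finset.sum_eq_single i]
      · simp [pd]
      · intro b _ hb; simp [hb]
      · simp
    unfold box
    have e2 := congrArg (fun F => ∫ x in Set.Icc (fun _ : Fin (n+1) => -(L / 2))
      (fun _ => L / 2), F x) e
    simp only at e2
    rw [← e2, h]
    apply Finset.sum_eq_zero
    intro j _
    by_cases hj : j = i
    · subst hj
      simp only [if_true]
      rw [sub_eq_zero]
      congr 1
      funext x
      rw [← hf (j.insertNth (-(L / 2)) x) j]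
      congr 1
      funext k
      refine Fin.succAboveCases j ?_ (fun k => ?_) k
      · simp; ring
      · simp
    · simp [hj]

theorem ibp {f g : (Fin d → ℝ) → ℝ} (hL : 0 < L) (hf : Per L f) (hc : ContDiff ℝ 1 f)
    (hg : Per L g) (hgc : ContDiff ℝ 1 g) (i : Fin d) :
    ∫ x in box L d, f x * pd i g x = - ∫ x in box L d, pd i f x * g x := by
  have := int_pd_zero hL (hf.mul hg) (hc.mul hgc) i
  simp_rw [pd_mul hc hgc] at this
  have e := bint_add (L := L) (f := fun x => f x * pd i g x) (g := fun x => pd i f x * g x)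
    (hc.continuous.mul (pd_cont hgc i)) ((pd_cont hc i).mul hgc.continuous)
  rw [e] at this
  linarith

theorem vitali {ι : Type*} {l : Filter ι} [l.IsCountablyGenerated]
    {F : ι → (Fin d → ℝ) → ℝ} {f : (Fin d → ℝ) → ℝ} {C M0 : ℝ}
    (hF : ∀ᶠ n in l, Continuous (F n)) (hC : ∀ᶠ n in l, ∫ x in box L d, (F n x) ^ 2 ≤ C)
    (hf : ∀ x ∈ box L d, |f x| ≤ M0)
    (hlim : ∀ x ∈ box L d, Tendsto (fun n => F n x) l (𝓝 (f x))) :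
    Tendsto (fun n => ∫ x in box L d, F n x) l (𝓝 (∫ x in box L d, f x)) := by
  rw [Metric.tendsto_nhds]
  intro ε hε
  obtain ⟨M, hM0, hM1, hM⟩ : ∃ M, 0 < M ∧ M0 ≤ M ∧ C / M < ε / 2 := by
    refine ⟨max (max 1 M0) (2 * |C| / ε + 1), ?_, ?_, ?_⟩
    · exact lt_of_lt_of_le one_pos ((le_max_left _ _).trans (le_max_left _ _))
    · exact (le_max_right _ _).trans (le_max_left _ _)
    · have h1 : (0:ℝ) < max (max 1 M0) (2 * |C| / ε + 1) :=
        lt_of_lt_of_le one_pos ((le_max_left _ _).trans (le_max_left _ _))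
      rw [div_lt_iff₀ h1]
      have h2 : 2 * |C| / ε + 1 ≤ max (max 1 M0) (2 * |C| / ε + 1) := le_max_right _ _
      have h3 : ε / 2 * (2 * |C| / ε + 1) = |C| + ε / 2 := by field_simp
      have h4 := le_abs_self C
      nlinarith
  let c : ℝ → ℝ := fun r => max (-M) (min r M)
  have hcc : Continuous c := by fun_prop
  have hcb : ∀ r, |c r| ≤ M := fun r => by
    rw [abs_le]
    exact ⟨le_max_left _ _, max_le (by linarith) (min_le_right _ _)⟩
  have hcd : ∀ r, |r - c r| ≤ r ^ 2 / M := fun r => by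
    rw [le_div_iff₀ hM0]
    simp only [c]
    rcases le_total r M with h | h
    · rw [min_eq_left h]
      rcases le_total (-M) r with h' | h'
      · rw [max_eq_right h']; simp; positivity
      · rw [max_eq_left h', abs_of_nonpos (by linarith)]; nlinarith
    · rw [min_eq_right h, max_eq_right (by linarith), abs_of_nonneg (by linarith)]; nlinarith
  have hcf : ∀ x ∈ box L d, c (f x) = f x := fun x hx => by
    have := abs_le.1 (hf x hx)
    simp only [c]
    rw [min_eq_left (by linarith), max_eq_right (by linarith)]
  have hT : Tendsto (fun n => ∫ x in box L d, c (F n x)) l (𝓝 (∫ x in box L d, f x)) := by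
    apply tendsto_integral_filter_of_dominated_convergence (fun _ => M)
    · filter_upwards [hF] with n hn
      exact (hcc.comp hn).aestronglyMeasurable
    · exact Eventually.of_forall fun n => Eventually.of_forall fun x => hcb _
    · exact integrable_const _
    · filter_upwards [ae_restrict_mem box_meas] with x hx
      have := (hcc.tendsto (f x)).comp (hlim x hx)
      rwa [hcf x hx] at this
  filter_upwards [hF, hC, (Metric.tendsto_nhds.1 hT) (ε / 2) (by linarith)] with n hn hCn hTn
  have h1 : |∫ x in box L d, F n x - c (F n x)| ≤ C / M := by
    calc |∫ x in box L d, F n x - c (F n x)| ≤ ∫ x in box L d, |F n x - c (F n x)| :=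
          abs_integral_le_integral_abs
      _ ≤ ∫ x in box L d, (F n x) ^ 2 / M := by
          apply integral_mono (cont_int (by fun_prop)) (cont_int (by fun_prop))
          intro x; exact hcd _
      _ = (∫ x in box L d, (F n x) ^ 2) / M := integral_div _ _
      _ ≤ C / M := by gcongr
  rw [bint_sub hn (hcc.comp' hn)] at h1
  rw [Real.dist_eq] at hTn ⊢
  have := abs_sub_le (∫ x in box L d, F n x) (∫ x in box L d, c (F n x)) (∫ x in box L d, f x)
  linarith

end basics

section static
open Filter Topology
variable {d : ℕ} {L : ℝ}

theorem conv_hasFDeriv {k f : (Fin d → ℝ) → ℝ} (hL : 0 < L) (hk : ContDiff ℝ 1 k) (hkp : Per L k)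
    (hf : Continuous f) (x : Fin d → ℝ) :
    HasFDerivAt (conv L k f) (∫ y in box L d, f y • fderiv ℝ k (x - y)) x := by
  have hkc : Continuous (fderiv ℝ k) := hk.continuous_fderiv one_ne_zero
  obtain ⟨C, hC0, hC⟩ := Per.bdd (f := fun x => ‖fderiv ℝ k x‖) hL (fun x i => by
    have : fderiv ℝ k (x + L • (Pi.single i 1 : Fin d → ℝ)) = fderiv ℝ k x := by
      rw [← fderiv_comp_add_right]
      congr 1
      funext y
      exact hkp y i
    simp only [this]) hkc.norm
  unfold conv
  refine hasFDerivAt_integral_of_dominated_of_fderiv_le (s := Set.univ)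
    (F := fun x y => k (x - y) * f y) (F' := fun x y => f y • fderiv ℝ k (x - y))
    (bound := fun y => |f y| * C) Filter.univ_mem ?_ ?_ ?_ ?_ ?_ ?_
  · refine Eventually.of_forall fun x => Continuous.aestronglyMeasurable ?_
    have := hk.continuous
    fun_prop
  · apply cont_int
    have := hk.continuous
    fun_prop
  · apply Continuous.aestronglyMeasurable
    fun_prop
  · refine Eventually.of_forall fun y x _ => ?_
    rw [norm_smul, Real.norm_eq_abs]
    have := hC (x - y)
    rw [abs_norm] at this
    gcongr
  · exact cont_int (by fun_prop)
  · refine Eventually.of_forall fun y x _ => ?_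
    have h1 := (hk.differentiable one_ne_zero (x - y)).hasFDerivAt
    have h2 : HasFDerivAt (fun x => k (x - y)) (fderiv ℝ k (x - y)) x := by
      have := h1.comp x ((hasFDerivAt_id x).sub_const y)
      simpa using! this
    exact h2.mul_const (f y)

theorem conv_pd {k f : (Fin d → ℝ) → ℝ} (hL : 0 < L) (hk : ContDiff ℝ 1 k) (hkp : Per L k)
    (hf : Continuous f) (i : Fin d) (x : Fin d → ℝ) :
    pd i (conv L k f) x = conv L (pd i k) f x := by
  have hkc : Continuous (fderiv ℝ k) := hk.continuous_fderiv one_ne_zero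
  unfold pd
  rw [(conv_hasFDeriv hL hk hkp hf x).fderiv, ContinuousLinearMap.integral_apply]
  · unfold conv
    congr 1
    funext y
    simp [mul_comm]
  · exact (Continuous.continuousOn (by fun_prop)).integrableOn_compact box_compact

theorem conv_cont {k f : (Fin d → ℝ) → ℝ} (hk : Continuous k)
    (hf : Continuous f) : Continuous (conv L k f) := by
  unfold conv
  apply continuous_parametric_integral_of_continuous (f := fun x y => k (x - y) * f y) _
    box_compact
  fun_prop

theorem conv_C1 {k f : (Fin d → ℝ) → ℝ} (hL : 0 < L) (hk : ContDiff ℝ 1 k) (hkp : Per L k)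
    (hf : Continuous f) : ContDiff ℝ 1 (conv L k f) := by
  have hkc : Continuous (fderiv ℝ k) := hk.continuous_fderiv one_ne_zero
  rw [contDiff_one_iff_fderiv]
  refine ⟨fun x => (conv_hasFDeriv hL hk hkp hf x).differentiableAt, ?_⟩
  have : fderiv ℝ (conv L k f) = fun x => ∫ y in box L d, f y • fderiv ℝ k (x - y) := by
    funext x
    exact (conv_hasFDeriv hL hk hkp hf x).fderiv
  rw [this]
  apply continuous_parametric_integral_of_continuous (f := fun x y => f y • fderiv ℝ k (x - y)) _
    box_compact
  fun_prop

theorem conv_bound {k f : (Fin d → ℝ) → ℝ} {C : ℝ} (hk : Continuous k) (hC : ∀ x, |k x| ≤ C)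
    (hf : Continuous f) (x : Fin d → ℝ) : |conv L k f x| ≤ C * ∫ y in box L d, |f y| := by
  unfold conv
  refine abs_integral_le_integral_abs.trans ?_
  rw [← integral_const_mul]
  apply bint_mono (by fun_prop) (by fun_prop)
  intro y
  rw [abs_mul]
  gcongr
  exact hC _

theorem conv_sub {k f g : (Fin d → ℝ) → ℝ} (hk : Continuous k)
    (hf : Continuous f) (hg : Continuous g) (x : Fin d → ℝ) :
    conv L k (fun y => f y - g y) x = conv L k f x - conv L k g x := by
  unfold conv
  rw [← bint_sub (by fun_prop) (by fun_prop)]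
  congr 1
  funext y
  ring

/-- right-hand side operator -/
def Aop (κ L : ℝ) (D f : (Fin d → ℝ) → ℝ) (x : Fin d → ℝ) : ℝ :=
  κ * divg (fun y i => f y * conv L (pd i D) f y) x + lap f x

/-- standing assumptions on the slice -/
structure Sl (L : ℝ) (f : (Fin d → ℝ) → ℝ) : Prop where
  C2 : ContDiff ℝ 2 f
  per : Per L f
  pos : ∀ x, 0 < f x
  mass : ∫ x in box L d, f x = 1

/-- standing assumptions on the potential -/
structure Po (L C0 : ℝ) (D : (Fin d → ℝ) → ℝ) : Prop where
  hL : 0 < L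
  C2 : ContDiff ℝ 2 D
  per : Per L D
  nn : 0 ≤ C0
  b1 : ∀ i x, |pd i D x| ≤ C0
  b2 : ∀ i x, |pd i (pd i D) x| ≤ C0

variable {C0 κ : ℝ} {D f g : (Fin d → ℝ) → ℝ}

theorem Sl.C1 (hf : Sl L f) : ContDiff ℝ 1 f := hf.C2.of_le (by norm_num)

theorem Po.Bd (hD : Po L C0 D) (hf : Sl L f) (i : Fin d) (x : Fin d → ℝ) :
    |conv L (pd i D) f x| ≤ C0 := by
  have h := conv_bound (L := L) (pd_C1 hD.C2 i).continuous (hD.b1 i) hf.C2.continuous x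
  simp_rw [abs_of_pos (hf.pos _)] at h
  rwa [hf.mass, mul_one] at h

theorem Po.dBd (hD : Po L C0 D) (hf : Sl L f) (i : Fin d) (x : Fin d → ℝ) :
    |pd i (conv L (pd i D) f) x| ≤ C0 := by
  rw [conv_pd hD.hL (pd_C1 hD.C2 i) (hD.per.pd i) hf.C2.continuous]
  have h := conv_bound (L := L) (pd_cont (pd_C1 hD.C2 i) i) (hD.b2 i) hf.C2.continuous x
  simp_rw [abs_of_pos (hf.pos _)] at h
  rwa [hf.mass, mul_one] at h

theorem Po.B1 (hD : Po L C0 D) (hf : Sl L f) (i : Fin d) :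
    ContDiff ℝ 1 (conv L (pd i D) f) :=
  conv_C1 hD.hL (pd_C1 hD.C2 i) (hD.per.pd i) hf.C2.continuous

theorem Po.Bper (hD : Po L C0 D) (i : Fin d) : Per L (conv L (pd i D) f) :=
  Per.conv (hD.per.pd i)

theorem Aop_eq (hD : Po L C0 D) (hf : Sl L f) (x : Fin d → ℝ) :
    Aop κ L D f x = ∑ i, (κ * pd i (fun y => f y * conv L (pd i D) f y) x + pd i (pd i f) x) := by
  unfold Aop divg lap
  rw [Finset.mul_sum, Finset.sum_add_distrib]

theorem Aop_cont (hD : Po L C0 D) (hf : Sl L f) : Continuous (Aop κ L D f) := by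
  rw [show Aop κ L D f = _ from funext fun x => Aop_eq hD hf x]
  have h1 := fun i => pd_cont (hf.C1.mul (hD.B1 hf i)) i
  have h2 := fun i => pd_cont (pd_C1 hf.C2 i) i
  fun_prop

theorem A_weak (hD : Po L C0 D) (hf : Sl L f) {p : (Fin d → ℝ) → ℝ} (hp : ContDiff ℝ 1 p)
    (hpp : Per L p) :
    ∫ x in box L d, p x * Aop κ L D f x
      = - ∑ i, ∫ x in box L d, pd i p x * (κ * (f x * conv L (pd i D) f x) + pd i f x) := by
  have h1 := fun i => pd_cont (hf.C1.mul (hD.B1 hf i)) i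
  have h2 := fun i => pd_cont (pd_C1 hf.C2 i) i
  have h3 := hp.continuous
  have h4 := fun i => pd_cont hp i
  have h5 := fun i => pd_cont hf.C1 i
  have h6 := hf.C2.continuous
  have h7 := fun i => (hD.B1 hf i).continuous
  simp_rw [Aop_eq hD hf, Finset.mul_sum]
  rw [bint_sum (fun i => by fun_prop), ← Finset.sum_neg_distrib]
  refine Finset.sum_congr rfl fun i _ => ?_
  have e1 := ibp hD.hL hpp hp (hf.per.mul (hD.Bper (f := f) i)) (hf.C1.mul (hD.B1 hf i)) i
  have e2 := ibp hD.hL hpp hp (hf.per.pd i) (pd_C1 hf.C2 i) i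
  have e3 : ∀ x, p x * (κ * pd i (fun y => f y * conv L (pd i D) f y) x + pd i (pd i f) x)
    = κ * (p x * pd i (fun y => f y * conv L (pd i D) f y) x) + p x * pd i (pd i f) x :=
    fun x => by ring
  have e4 : ∀ x, pd i p x * (κ * (f x * conv L (pd i D) f x) + pd i f x)
    = κ * (pd i p x * (f x * conv L (pd i D) f x)) + pd i p x * pd i f x :=
    fun x => by ring
  simp_rw [e3, e4]
  rw [bint_add (by fun_prop) (by fun_prop), bint_add (by fun_prop) (by fun_prop),
    integral_const_mul, integral_const_mul, e1, e2]
  ring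

theorem vol_eq (hL : 0 < L) : ∫ _x in box L d, (1:ℝ) = L ^ d := by
  have : volume (box L d) = ENNReal.ofReal (L ^ d) := by
    unfold box
    rw [Real.volume_Icc_pi]
    simp only [sub_neg_eq_add, add_halves, Finset.prod_const, Finset.card_univ, Fintype.card_fin]
    rw [ENNReal.ofReal_pow hL.le]
  simp [Measure.real, this, hL.le]

theorem bint_const (hL : 0 < L) (c : ℝ) : ∫ _x in box L d, c = c * L ^ d := by
  rw [← vol_eq hL, ← integral_const_mul]
  simp

theorem l1_l2 (hL : 0 < L) {w : (Fin d → ℝ) → ℝ} (hw : Continuous w) :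
    (∫ x in box L d, |w x|) ^ 2 ≤ L ^ d * ∫ x in box L d, (w x) ^ 2 := by
  set m := ∫ x in box L d, |w x| with hm
  have hV : 0 < L ^ d := by positivity
  have h0 : 0 ≤ ∫ x in box L d, (L ^ d * |w x| - m) ^ 2 :=
    integral_nonneg fun x => sq_nonneg _
  have e : ∀ x, (L ^ d * |w x| - m) ^ 2
      = ((L ^ d) ^ 2 * (w x) ^ 2 - 2 * L ^ d * m * |w x|) + m ^ 2 := fun x => by
    rw [← sq_abs (w x)]; ring
  simp_rw [e] at h0
  rw [bint_add (by fun_prop) (by fun_prop), bint_sub (by fun_prop) (by fun_prop),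
    integral_const_mul, integral_const_mul, bint_const hL, ← hm] at h0
  have : 0 ≤ L ^ d * (L ^ d * (∫ x in box L d, (w x) ^ 2) - m ^ 2) := by linarith
  have := nonneg_of_mul_nonneg_right this hV
  linarith

/-- the constant in the energy estimate -/
def CE (d : ℕ) (L κ C0 K : ℝ) : ℝ := d * (κ ^ 2 * C0 ^ 2 * (1 + K ^ 2 * (L ^ d) ^ 2) / 2)

theorem energy (hD : Po L C0 D) (hf : Sl L f) (hg : Sl L g) {K : ℝ} (hK : ∀ x, g x ≤ K) :
    ∫ x in box L d, (f x - g x) * (Aop κ L D f x - Aop κ L D g x)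
      ≤ CE d L κ C0 K * ∫ x in box L d, (f x - g x) ^ 2 := by
  have a1 := fun i => pd_cont hf.C1 i
  have a2 := fun i => pd_cont hg.C1 i
  have a3 := hf.C2.continuous
  have a4 := hg.C2.continuous
  have a5 := fun i => (hD.B1 hf i).continuous
  have a6 := fun i => (hD.B1 hg i).continuous
  have a7 := Aop_cont (κ := κ) hD hf
  have a8 := Aop_cont (κ := κ) hD hg
  have hw := hf.C1.sub hg.C1
  have hwp := hf.per.sub hg.per
  have hV : 0 < L ^ d := pow_pos hD.hL d
  have e0 : ∀ x, (f x - g x) * (Aop κ L D f x - Aop κ L D g x)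
    = (f x - g x) * Aop κ L D f x - (f x - g x) * Aop κ L D g x := fun x => by ring
  simp_rw [e0]
  rw [bint_sub (by fun_prop) (by fun_prop), A_weak hD hf hw hwp, A_weak hD hg hw hwp,
    neg_sub_neg, ← Finset.sum_sub_distrib]
  set W := ∫ x in box L d, (f x - g x) ^ 2 with hW
  set m := ∫ x in box L d, |f x - g x| with hm
  have hmW : m ^ 2 ≤ L ^ d * W := l1_l2 hD.hL (w := fun x => f x - g x) (by fun_prop)
  calc _ ≤ ∑ i : Fin d, κ ^ 2 * C0 ^ 2 * (1 + K ^ 2 * (L ^ d) ^ 2) / 2 * W := by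
        refine Finset.sum_le_sum fun i _ => ?_
        have b1 : Continuous (pd i fun x => f x - g x) := pd_cont hw i
        rw [← bint_sub (by fun_prop) (by fun_prop)]
        have hp : ∀ x, pd i (fun x => f x - g x) x * (κ * (g x * conv L (pd i D) g x) + pd i g x)
            - pd i (fun x => f x - g x) x * (κ * (f x * conv L (pd i D) f x) + pd i f x)
            ≤ κ ^ 2 * C0 ^ 2 / 2 * (f x - g x) ^ 2 + κ ^ 2 * C0 ^ 2 * K ^ 2 / 2 * m ^ 2 := by
          intro x
          rw [pd_sub hf.C1 hg.C1]
          set p := pd i f x - pd i g x with hpd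
          set w := f x - g x with hwd
          have hB := hD.Bd hf i x
          have hBw := conv_bound (L := L) (pd_C1 hD.C2 i).continuous (hD.b1 i)
            (f := fun y => f y - g y) (by fun_prop) x
          rw [conv_sub (pd_C1 hD.C2 i).continuous a3 a4, ← hm] at hBw
          set Bf := conv L (pd i D) f x
          set Bg := conv L (pd i D) g x
          have hm0 : 0 ≤ m := integral_nonneg fun _ => abs_nonneg _
          have h1 : (w * Bf) ^ 2 ≤ C0 ^ 2 * w ^ 2 := by
            have : Bf ^ 2 ≤ C0 ^ 2 := sq_le_sq' (abs_le.1 hB).1 (abs_le.1 hB).2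
            nlinarith [sq_nonneg w]
          have h2 : (g x * (Bf - Bg)) ^ 2 ≤ C0 ^ 2 * K ^ 2 * m ^ 2 := by
            have t1 : (Bf - Bg) ^ 2 ≤ (C0 * m) ^ 2 := sq_le_sq' (abs_le.1 hBw).1 (abs_le.1 hBw).2
            have t2 : g x ^ 2 ≤ K ^ 2 := by
              have := hg.pos x
              have := hK x
              nlinarith
            calc (g x * (Bf - Bg)) ^ 2 = g x ^ 2 * (Bf - Bg) ^ 2 := by ring
              _ ≤ K ^ 2 * (C0 * m) ^ 2 := by gcongr
              _ = _ := by ring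
          have e : p * (κ * (g x * Bg) + pd i g x) - p * (κ * (f x * Bf) + pd i f x)
              = - p ^ 2 - p * κ * (w * Bf + g x * (Bf - Bg)) := by
            simp only [hpd, hwd]; ring
          rw [e]
          have h3 := sq_nonneg (p + κ * (w * Bf + g x * (Bf - Bg)) / 2)
          have h4 := sq_nonneg (w * Bf - g x * (Bf - Bg))
          have h5 : (w * Bf + g x * (Bf - Bg)) ^ 2 ≤ 2 * (C0 ^ 2 * w ^ 2)
            + 2 * (C0 ^ 2 * K ^ 2 * m ^ 2) := by nlinarith
          have h6 := mul_le_mul_of_nonneg_left h5 (sq_nonneg κ)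
          nlinarith
        refine (bint_mono (by fun_prop) (by fun_prop) hp).trans ?_
        rw [bint_add (by fun_prop) (by fun_prop), integral_const_mul, bint_const hD.hL, ← hW]
        have := mul_le_mul_of_nonneg_left hmW
          (show 0 ≤ κ ^ 2 * C0 ^ 2 * K ^ 2 / 2 * L ^ d by positivity)
        nlinarith
    _ = _ := by
      rw [Finset.sum_const, Finset.card_univ, Fintype.card_fin, CE]
      simp; ring

/-- regularised (twice the) positive part and derivatives -/
def be (e u : ℝ) : ℝ := u + √(u ^ 2 + e ^ 2)
def be' (e u : ℝ) : ℝ := 1 + u / √(u ^ 2 + e ^ 2)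
def be'' (e u : ℝ) : ℝ := e ^ 2 / (√(u ^ 2 + e ^ 2)) ^ 3

theorem be_deriv {e : ℝ} (he : 0 < e) (u : ℝ) : HasDerivAt (be e) (be' e u) u := by
  have h : u ^ 2 + e ^ 2 ≠ 0 := by positivity
  have h1 : HasDerivAt (fun u : ℝ => u ^ 2 + e ^ 2) (2 * u) u := by
    simpa using (hasDerivAt_pow 2 u).add_const (e ^ 2)
  have := (hasDerivAt_id u).add (h1.sqrt h)
  unfold be be'
  convert! this using 1
  field_simp

theorem be'_deriv {e : ℝ} (he : 0 < e) (u : ℝ) : HasDerivAt (be' e) (be'' e u) u := by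
  have h : 0 < u ^ 2 + e ^ 2 := by positivity
  have h1 : HasDerivAt (fun u : ℝ => u ^ 2 + e ^ 2) (2 * u) u := by
    simpa using (hasDerivAt_pow 2 u).add_const (e ^ 2)
  have h2 := ((hasDerivAt_id u).div (h1.sqrt h.ne') (Real.sqrt_pos.2 h).ne').const_add 1
  unfold be' be''
  convert! h2 using 1
  have h3 := Real.sq_sqrt h.le
  have h4 := Real.sqrt_pos.2 h
  simp only [id]
  field_simp
  rw [h3]; ring

theorem be'_C1 {e : ℝ} (he : 0 < e) : ContDiff ℝ 1 (be' e) := by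
  unfold be'
  refine contDiff_const.add (contDiff_id.div (ContDiff.sqrt (by fun_prop) fun u => ?_) fun u => ?_)
  · positivity
  · have : 0 < u ^ 2 + e ^ 2 := by positivity
    exact (Real.sqrt_pos.2 this).ne'

theorem be_C1 {e : ℝ} (he : 0 < e) : ContDiff ℝ 1 (be e) := by
  unfold be
  refine contDiff_id.add (ContDiff.sqrt (by fun_prop) fun u => ?_)
  positivity

theorem be''_nn {e : ℝ} (u : ℝ) : 0 ≤ be'' e u := by unfold be''; positivity

theorem be_aux {e : ℝ} (he : 0 < e) (u : ℝ) : |u| < √(u ^ 2 + e ^ 2) := by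
  rw [← Real.sqrt_sq_eq_abs]
  exact Real.sqrt_lt_sqrt (sq_nonneg _) (by nlinarith)

theorem be_ge {e : ℝ} (he : 0 < e) (u : ℝ) : 2 * max u 0 ≤ be e u := by
  have := abs_lt.1 (be_aux he u)
  unfold be
  rcases le_total u 0 with h | h
  · rw [max_eq_right h]; linarith
  · rw [max_eq_left h]; linarith

theorem be'_nn {e : ℝ} (he : 0 < e) (u : ℝ) : 0 ≤ be' e u := by
  have h := be_aux he u
  have h2 := abs_lt.1 h
  have h3 : 0 < √(u ^ 2 + e ^ 2) := (abs_nonneg u).trans_lt h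
  unfold be'
  rw [← neg_le_iff_add_nonneg', le_div_iff₀ h3]
  linarith

theorem be'_le {e : ℝ} (he : 0 < e) (u : ℝ) : be' e u ≤ 2 := by
  have h := be_aux he u
  have h2 := abs_lt.1 h
  have h3 : 0 < √(u ^ 2 + e ^ 2) := (abs_nonneg u).trans_lt h
  unfold be'
  have : u / √(u ^ 2 + e ^ 2) ≤ 1 := by rw [div_le_one h3]; linarith
  linarith

theorem be'_mul {e : ℝ} (he : 0 < e) (u : ℝ) : |be' e u * u| ≤ be e u := by
  have h := be_aux he u
  have h3 : 0 < √(u ^ 2 + e ^ 2) := (abs_nonneg u).trans_lt h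
  have e1 : be' e u * √(u ^ 2 + e ^ 2) = be e u := by
    unfold be be'; field_simp; ring
  rw [abs_mul, abs_of_nonneg (be'_nn he u), ← e1]
  exact mul_le_mul_of_nonneg_left h.le (be'_nn he u)

theorem be_neg {e u : ℝ} (he : 0 < e) (hu : u ≤ 0) : be e u ≤ e := by
  unfold be
  have : √(u ^ 2 + e ^ 2) ≤ e - u := by
    rw [Real.sqrt_le_left (by linarith)]; nlinarith
  linarith

theorem be_flip (e u : ℝ) : be e u = 2 * u + be e (-u) := by
  unfold be; rw [neg_sq]; ring

theorem sup_static (hD : Po L C0 D) (hκ : 0 < κ) (hf : Sl L f) {e y : ℝ} (he : 0 < e)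
    (hy : 0 ≤ y) :
    ∫ x in box L d, be' e (f x - y) * Aop κ L D f x ≤
      κ * d * C0 * ∫ x in box L d, (2 * be e (f x - y) + y * be' e (f x - y)) := by
  have hu : ContDiff ℝ 1 (fun x => f x - y) := hf.C1.sub contDiff_const
  have hb : ContDiff ℝ 1 (fun x => be e (f x - y)) := (be_C1 he).comp hu
  have hb' : ContDiff ℝ 1 (fun x => be' e (f x - y)) := (be'_C1 he).comp hu
  have hbp : Per L (fun x => be' e (f x - y)) := hf.per.comp (fun r => be' e (r - y))
  let h : ℝ → ℝ := fun r => be' e (r - y) * r - be e (r - y)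
  have hh : ContDiff ℝ 1 (fun x => h (f x)) := (hb'.mul hf.C1).sub hb
  have hhp : Per L (fun x => h (f x)) := hf.per.comp h
  have a1 := fun i => pd_cont hf.C1 i
  have a3 := hf.C2.continuous
  have a5 := fun i => (hD.B1 hf i).continuous
  have a6 := fun i => pd_cont (hD.B1 hf i) i
  have a7 := hb.continuous
  have a8 := hb'.continuous
  have hd : ∀ i x, pd i (fun x => be' e (f x - y)) x = be'' e (f x - y) * pd i f x := by
    intro i x
    refine pd_comp (b := fun r => be' e (r - y)) hf.C1 i x ?_
    simpa using (be'_deriv he (f x - y)).comp_sub_const (f x) y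
  have hdh : ∀ i x, pd i (fun x => h (f x)) x = be'' e (f x - y) * f x * pd i f x := by
    intro i x
    refine pd_comp (b := h) hf.C1 i x ?_
    have t1 := (be'_deriv he (f x - y)).comp_sub_const (f x) y
    have t2 := (be_deriv he (f x - y)).comp_sub_const (f x) y
    have := (t1.mul (hasDerivAt_id (f x))).sub t2
    convert! this using 1
    simp
  rw [A_weak hD hf hb' hbp, ← Finset.sum_neg_distrib]
  set R := ∫ x in box L d, (2 * be e (f x - y) + y * be' e (f x - y)) with hR
  calc _ ≤ ∑ i : Fin d, κ * (C0 * R) := by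
        refine Finset.sum_le_sum fun i _ => ?_
        have b1 : Continuous (pd i fun x => h (f x)) := pd_cont hh i
        have b2 : Continuous (pd i fun x => be' e (f x - y)) := pd_cont hb' i
        have b3 := hh.continuous
        have hp : ∀ x, -(κ * (pd i (fun x => h (f x)) x * conv L (pd i D) f x)) ≥
            - (pd i (fun x => be' e (f x - y)) x *
              (κ * (f x * conv L (pd i D) f x) + pd i f x)) := by
          intro x
          rw [hd, hdh]
          have := mul_nonneg (be''_nn (e := e) (f x - y)) (sq_nonneg (pd i f x))
          nlinarith
        rw [← integral_neg]
        refine (bint_mono (by fun_prop) (by fun_prop) hp).trans ?_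
        rw [integral_neg, integral_const_mul]
        have t := ibp hD.hL hhp hh (hD.Bper (f := f) i) (hD.B1 hf i) i
        rw [← mul_neg, ← t]
        refine mul_le_mul_of_nonneg_left ?_ hκ.le
        rw [hR, ← integral_const_mul]
        refine bint_mono (b3.mul (a6 i)) (by fun_prop) fun x => ?_
        have q1 := hD.dBd hf i x
        have q2 := abs_le.1 (be'_mul he (f x - y))
        have q3 := be'_nn he (f x - y)
        have q4 : |h (f x)| ≤ 2 * be e (f x - y) + y * be' e (f x - y) := by
          have : h (f x) = be' e (f x - y) * (f x - y) - be e (f x - y)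
            + y * be' e (f x - y) := by simp only [h]; ring
          have q5 := mul_nonneg hy q3
          rw [this, abs_le]
          constructor <;> linarith
        refine (le_abs_self _).trans ?_
        rw [abs_mul, mul_comm]
        exact mul_le_mul q1 q4 (abs_nonneg _) hD.nn
    _ = _ := by
      rw [Finset.sum_const, Finset.card_univ, Fintype.card_fin]
      simp; ring

end static

section timed
open Filter Topology
variable {d : ℕ} {L κ C0 : ℝ} {D : (Fin d → ℝ) → ℝ} {ρ : ℝ → (Fin d → ℝ) → ℝ}

/-- the solution package -/
structure Sol (κ L C0 : ℝ) (D : (Fin d → ℝ) → ℝ) (ρ : ℝ → (Fin d → ℝ) → ℝ) : Prop where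
  hD : Po L C0 D
  hκ : 0 < κ
  sl : ∀ t > 0, Sl L (ρ t)
  ev : ∀ t > 0, ∀ x, HasDerivAt (fun s => ρ s x) (Aop κ L D (ρ t) x) t

theorem Sol.ct (hS : Sol κ L C0 D ρ) {t : ℝ} (ht : 0 < t) : Continuous (ρ t) :=
  (hS.sl t ht).C2.continuous

theorem Sol.cA (hS : Sol κ L C0 D ρ) {t : ℝ} (ht : 0 < t) : Continuous (Aop κ L D (ρ t)) :=
  Aop_cont hS.hD (hS.sl t ht)

theorem one_dim {f g : ℝ → ℝ} {a b : ℝ} (hab : a ≤ b) (hg : Measurable g)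
    (h : ∀ s ∈ Set.Icc a b, HasDerivAt f (g s) s) :
    ENNReal.ofReal ((f b - f a) ^ 2) ≤
      ENNReal.ofReal (b - a) * ∫⁻ s in Set.Icc a b, ENNReal.ofReal ((g s) ^ 2) := by
  rcases hab.eq_or_lt with rfl | hlt
  · simp
  by_cases htop : ∫⁻ s in Set.Icc a b, ENNReal.ofReal ((g s) ^ 2) = ⊤
  · rw [htop, ENNReal.mul_top]
    · exact le_top
    · simpa using hlt
  have hint2 : IntegrableOn (fun s => (g s) ^ 2) (Set.Icc a b) := by
    refine ⟨(hg.pow_const 2).aestronglyMeasurable, ?_⟩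
    rw [hasFiniteIntegral_iff_ofReal (Eventually.of_forall fun x => sq_nonneg _)]
    exact lt_top_iff_ne_top.2 htop
  have : IsFiniteMeasure (volume.restrict (Set.Icc a b)) := ⟨by simp⟩
  have hint : IntegrableOn g (Set.Icc a b) := by
    have : MemLp g 2 (volume.restrict (Set.Icc a b)) :=
      (memLp_two_iff_integrable_sq hg.aestronglyMeasurable).2 hint2
    exact this.integrable (by norm_num)
  have e1 : ∫ s in Set.Icc a b, g s = f b - f a := by
    rw [integral_Icc_eq_integral_Ioc, ← intervalIntegral.integral_of_le hab]
    refine intervalIntegral.integral_eq_sub_of_hasDerivAt (fun x hx => h x ?_) ?_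
    · rwa [Set.uIcc_of_le hab] at hx
    · rw [intervalIntegrable_iff_integrableOn_Icc_of_le hab]; exact hint
  rw [← ofReal_integral_eq_lintegral_ofReal hint2 (Eventually.of_forall fun x => sq_nonneg _),
    ← ENNReal.ofReal_mul (by linarith)]
  apply ENNReal.ofReal_le_ofReal
  set m := (f b - f a) / (b - a) with hm
  have hba : 0 < b - a := by linarith
  have h0 : 0 ≤ ∫ s in Set.Icc a b, (g s - m) ^ 2 := integral_nonneg fun s => sq_nonneg _
  have e2 : ∫ s in Set.Icc a b, (g s - m) ^ 2 =
      (∫ s in Set.Icc a b, (g s) ^ 2) - 2 * m * (f b - f a) + m ^ 2 * (b - a) := by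
    have : ∀ s, (g s - m) ^ 2 = ((g s) ^ 2 - 2 * m * g s) + m ^ 2 := fun s => by ring
    simp_rw [this]
    have i1 : Integrable (fun s => (g s) ^ 2 - 2 * m * g s) (volume.restrict (Set.Icc a b)) :=
      Integrable.sub hint2 (Integrable.const_mul hint _)
    rw [integral_add i1 (integrable_const _),
      integral_sub hint2 (Integrable.const_mul hint _), integral_const_mul, e1]
    simp [Measure.real, hab]
    ring
  rw [e2] at h0
  have e3 : m * (b - a) = f b - f a := by rw [hm]; field_simp
  nlinarith [mul_nonneg hba.le h0]

theorem Sol.meas (hS : Sol κ L C0 D ρ) {s1 : ℝ} (h1 : 0 < s1) :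
    Measurable (fun p : ℝ × (Fin d → ℝ) =>
      if s1 ≤ p.1 then Aop κ L D (ρ p.1) p.2 else 0) := by
  have hc : ∀ x, Continuous (fun s => ρ (max s s1) x) := by
    intro x
    have : ContinuousOn (fun s => ρ s x) (Set.Ici s1) := fun s hs =>
      (hS.ev s (h1.trans_le hs) x).continuousAt.continuousWithinAt
    exact this.comp_continuous (by fun_prop) fun s => Set.mem_Ici.2 (le_max_right _ _)
  have hm : Measurable (fun p : (Fin d → ℝ) × ℝ => ρ (max p.2 s1) p.1) := by
    refine measurable_uncurry_of_continuous_of_measurable (u := fun x s => ρ (max s s1) x)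
      (fun s => ?_) (fun x => (hc x).measurable)
    exact hS.ct (lt_max_of_lt_right h1)
  have hm1 : Measurable (fun p : ℝ × (Fin d → ℝ) => ρ (max p.1 s1) p.2) :=
    hm.comp measurable_swap
  refine measurable_of_tendsto_metrizable
    (f := fun (n : ℕ) (p : ℝ × (Fin d → ℝ)) => ((n:ℝ) + 1) *
      (ρ (max (p.1 + 1 / ((n:ℝ) + 1)) s1) p.2 - ρ (max p.1 s1) p.2)) ?_ ?_
  · intro n
    have hm2 : Measurable (fun p : ℝ × (Fin d → ℝ) => ρ (max (p.1 + 1 / ((n:ℝ) + 1)) s1) p.2) := by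
      have : Measurable (fun p : ℝ × (Fin d → ℝ) => (p.1 + 1 / ((n:ℝ) + 1), p.2)) := by fun_prop
      exact hm1.comp this
    exact (hm2.sub hm1).const_mul _
  · rw [tendsto_pi_nhds]
    rintro ⟨s, x⟩
    have hn : Tendsto (fun n : ℕ => 1 / ((n:ℝ) + 1)) atTop (𝓝 0) :=
      tendsto_one_div_add_atTop_nhds_zero_nat
    by_cases hs : s1 ≤ s
    · simp only [hs, if_true]
      have h2 := (hS.ev s (h1.trans_le hs) x).tendsto_slope_zero
      have hn' : Tendsto (fun n : ℕ => 1 / ((n:ℝ) + 1)) atTop (𝓝[≠] 0) := by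
        refine tendsto_nhdsWithin_iff.2 ⟨hn, Eventually.of_forall fun n => ?_⟩
        simp
        positivity
      refine (h2.comp hn').congr fun n => ?_
      have : 0 < 1 / ((n:ℝ) + 1) := by positivity
      simp only [Function.comp]
      rw [max_eq_left (by linarith), max_eq_left hs, smul_eq_mul]
      simp
    · simp only [hs, if_false]
      push Not at hs
      refine tendsto_const_nhds.congr' ?_
      have : ∀ᶠ n : ℕ in atTop, 1 / ((n:ℝ) + 1) < s1 - s := hn.eventually_lt_const (by linarith)
      filter_upwards [this] with n hn
      rw [max_eq_right hs.le, max_eq_right (by linarith)]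
      simp

theorem Sol.lip (hS : Sol κ L C0 D ρ) {s1 s2 N : ℝ} (h1 : 0 < s1) (h12 : s1 ≤ s2)
    (hN : ∀ s ∈ Set.Icc s1 s2, ∫ x in box L d, (Aop κ L D (ρ s) x) ^ 2 ≤ N) :
    ∫ x in box L d, (ρ s2 x - ρ s1 x) ^ 2 ≤ N * (s2 - s1) ^ 2 := by
  have hN0 : 0 ≤ N := (integral_nonneg fun x => sq_nonneg _).trans (hN s1 ⟨le_rfl, h12⟩)
  have c1 := hS.ct h1
  have c2 := hS.ct (h1.trans_le h12)
  rw [← ENNReal.ofReal_le_ofReal_iff (by positivity), ofReal_integral_eq_lintegral_ofReal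
    (cont_int (by fun_prop)) (Eventually.of_forall fun x => sq_nonneg _)]
  set G : ℝ × (Fin d → ℝ) → ℝ := fun p => if s1 ≤ p.1 then Aop κ L D (ρ p.1) p.2 else 0 with hG
  have hGm : Measurable G := hS.meas h1
  calc _ ≤ ∫⁻ x in box L d, ENNReal.ofReal (s2 - s1) *
          ∫⁻ s in Set.Icc s1 s2, ENNReal.ofReal ((G (s, x)) ^ 2) := by
        refine lintegral_mono fun x => ?_
        refine one_dim (f := fun s => ρ s x) (g := fun s => G (s, x)) h12 (by fun_prop) ?_
        intro s hs
        simp only [hG, hs.1, if_true]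
        exact hS.ev s (h1.trans_le hs.1) x
    _ = ENNReal.ofReal (s2 - s1) * ∫⁻ s in Set.Icc s1 s2, ∫⁻ x in box L d,
          ENNReal.ofReal ((G (s, x)) ^ 2) := by
        rw [lintegral_const_mul' _ _ ENNReal.ofReal_ne_top, lintegral_lintegral_swap]
        have : Measurable (fun p : (Fin d → ℝ) × ℝ => ENNReal.ofReal ((G (p.2, p.1)) ^ 2)) := by
          fun_prop
        exact this.aemeasurable
    _ ≤ ENNReal.ofReal (s2 - s1) * ∫⁻ s in Set.Icc s1 s2, ENNReal.ofReal N := by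
        refine mul_le_mul_right ?_ _
        refine setLIntegral_mono' measurableSet_Icc fun s hs => ?_
        have c3 := hS.cA (h1.trans_le hs.1)
        simp only [hG, hs.1, if_true]
        rw [← ofReal_integral_eq_lintegral_ofReal
          (cont_int (by fun_prop)) (Eventually.of_forall fun x => sq_nonneg _)]
        exact ENNReal.ofReal_le_ofReal (hN s hs)
    _ = _ := by
        rw [setLIntegral_const, Real.volume_Icc, ← ENNReal.ofReal_mul hN0,
          ← ENNReal.ofReal_mul (by linarith)]
        congr 1
        ring

end timed

section ld
open Filter Topology
variable {d : ℕ} {L κ C0 : ℝ} {D : (Fin d → ℝ) → ℝ} {ρ : ℝ → (Fin d → ℝ) → ℝ}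

/-- differentiable family, with difference quotients bounded in `L²` -/
structure LD (L : ℝ) (P : ℝ → (Fin d → ℝ) → ℝ) (P' : (Fin d → ℝ) → ℝ) (t : ℝ) : Prop where
  ct : ∀ᶠ s in 𝓝 t, Continuous (P s)
  c' : Continuous P'
  lip : ∃ N, ∀ᶠ s in 𝓝 t, ∫ x in box L d, (P s x - P t x) ^ 2 ≤ N * (s - t) ^ 2
  der : ∀ x, HasDerivAt (fun s => P s x) (P' x) t

theorem LD.deriv {P : ℝ → (Fin d → ℝ) → ℝ} {P' : (Fin d → ℝ) → ℝ} {t : ℝ} (h : LD L P P' t) :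
    HasDerivAt (fun s => ∫ x in box L d, P s x) (∫ x in box L d, P' x) t := by
  obtain ⟨N, hN⟩ := h.lip
  obtain ⟨M, hM⟩ := (box_compact (L := L) (d := d)).exists_bound_of_continuousOn h.c'.continuousOn
  have h0 := h.ct.self_of_nhds
  rw [hasDerivAt_iff_tendsto_slope]
  have := vitali (L := L) (l := 𝓝[≠] t) (F := fun s x => slope (fun s => P s x) t s) (f := P')
    (C := N) (M0 := M) ?_ ?_ hM fun x _ => hasDerivAt_iff_tendsto_slope.1 (h.der x)
  · refine this.congr' ?_
    filter_upwards [h.ct.filter_mono nhdsWithin_le_nhds] with s hs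
    simp only [slope_def_field]
    rw [integral_div, bint_sub hs h0]
  · filter_upwards [h.ct.filter_mono nhdsWithin_le_nhds] with s hs
    simp only [slope_def_field]
    fun_prop
  · filter_upwards [hN.filter_mono nhdsWithin_le_nhds, self_mem_nhdsWithin] with s hs hst
    simp only [slope_def_field, div_pow]
    have : 0 < (s - t) ^ 2 := by
      have : s - t ≠ 0 := sub_ne_zero.2 hst
      positivity
    rw [integral_div, div_le_iff₀ this]
    exact hs

theorem LD.sub {P Q : ℝ → (Fin d → ℝ) → ℝ} {P' Q' : (Fin d → ℝ) → ℝ} {t : ℝ} (h : LD L P P' t)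
    (k : LD L Q Q' t) : LD L (fun s x => P s x - Q s x) (fun x => P' x - Q' x) t := by
  obtain ⟨N, hN⟩ := h.lip
  obtain ⟨M, hM⟩ := k.lip
  have h0 := h.ct.self_of_nhds
  have k0 := k.ct.self_of_nhds
  refine ⟨?_, h.c'.sub k.c', ⟨2 * N + 2 * M, ?_⟩, fun x => (h.der x).sub (k.der x)⟩
  · filter_upwards [h.ct, k.ct] with s h1 h2 using h1.sub h2
  · filter_upwards [h.ct, k.ct, hN, hM] with s h1 h2 h3 h4
    calc _ ≤ ∫ x in box L d, (2 * (P s x - P t x) ^ 2 + 2 * (Q s x - Q t x) ^ 2) := by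
          refine bint_mono (by fun_prop) (by fun_prop) fun x => ?_
          nlinarith [sq_nonneg ((P s x - P t x) + (Q s x - Q t x))]
      _ = 2 * (∫ x in box L d, (P s x - P t x) ^ 2) + 2 * ∫ x in box L d, (Q s x - Q t x) ^ 2 := by
          rw [bint_add (by fun_prop) (by fun_prop), integral_const_mul, integral_const_mul]
      _ ≤ _ := by linarith

theorem LD.comp {P : ℝ → (Fin d → ℝ) → ℝ} {P' : (Fin d → ℝ) → ℝ} {t c : ℝ} (h : LD L P P' t)
    {b b' : ℝ → ℝ} (hb : ∀ u, HasDerivAt b (b' u) u) (hb' : Continuous b')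
    (hl : ∀ᶠ s in 𝓝 t, ∀ x, |b (P s x) - b (P t x)| ≤ c * |P s x - P t x|) :
    LD L (fun s x => b (P s x)) (fun x => b' (P t x) * P' x) t := by
  obtain ⟨N, hN⟩ := h.lip
  have h0 := h.ct.self_of_nhds
  have hc := h.c'
  have bc : Continuous b := continuous_iff_continuousAt.2 fun u => (hb u).continuousAt
  refine ⟨?_, by fun_prop, ⟨c ^ 2 * N, ?_⟩, fun x => (hb _).comp t (h.der x)⟩
  · filter_upwards [h.ct] with s h1
    fun_prop
  · filter_upwards [h.ct, hN, hl] with s h1 h2 h3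
    calc _ ≤ ∫ x in box L d, (c ^ 2 * (P s x - P t x) ^ 2) := by
          refine bint_mono (by fun_prop) (by fun_prop) fun x => ?_
          rw [← sq_abs, ← sq_abs (P s x - _), ← mul_pow]
          exact pow_le_pow_left₀ (abs_nonneg _) (h3 x) 2
      _ ≤ _ := by
          rw [integral_const_mul, mul_assoc]
          exact mul_le_mul_of_nonneg_left h2 (sq_nonneg _)

theorem LD.sq {P : ℝ → (Fin d → ℝ) → ℝ} {P' : (Fin d → ℝ) → ℝ} {t K : ℝ} (h : LD L P P' t)
    (hK : ∀ᶠ s in 𝓝 t, ∀ x, |P s x| ≤ K) :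
    LD L (fun s x => (P s x) ^ 2) (fun x => 2 * P t x * P' x) t := by
  have h0 := hK.self_of_nhds
  refine LD.comp (c := 2 * K) (b := fun u => u ^ 2) (b' := fun u => 2 * u) h (fun u => ?_)
    (by fun_prop) ?_
  · simpa using hasDerivAt_pow 2 u
  · filter_upwards [hK] with s hs x
    rw [sq_sub_sq, abs_mul]
    refine mul_le_mul_of_nonneg_right ?_ (abs_nonneg _)
    have := abs_add_le (P s x) (P t x)
    linarith [hs x, h0 x]

theorem LD.const {g : (Fin d → ℝ) → ℝ} (hg : Continuous g) (t : ℝ) :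
    LD L (fun _ => g) (fun _ => 0) t :=
  ⟨Eventually.of_forall fun _ => hg, continuous_const, ⟨0, by simp⟩,
    fun x => hasDerivAt_const _ _⟩

theorem LD.num (hL : 0 < L) {y : ℝ → ℝ} {y' t : ℝ} (hy : HasDerivAt y y' t) :
    LD (d := d) L (fun s _ => y s) (fun _ => y') t := by
  refine ⟨Eventually.of_forall fun _ => continuous_const, continuous_const, ?_, fun x => hy⟩
  obtain ⟨c, hc⟩ := hy.isBigO_sub.bound
  refine ⟨c ^ 2 * L ^ d, ?_⟩
  filter_upwards [hc] with s hs
  rw [bint_const hL]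
  have : (y s - y t) ^ 2 ≤ c ^ 2 * (s - t) ^ 2 := by
    rw [← sq_abs, ← sq_abs (s - t), ← mul_pow]
    exact pow_le_pow_left₀ (abs_nonneg _) hs 2
  have h2 : 0 < L ^ d := by positivity
  nlinarith

/-- times near which `∂ₜρ` is bounded in `L²` -/
def Good (κ L : ℝ) (D : (Fin d → ℝ) → ℝ) (ρ : ℝ → (Fin d → ℝ) → ℝ) (t : ℝ) : Prop :=
  ∃ N, ∀ᶠ s in 𝓝 t, ∫ x in box L d, (Aop κ L D (ρ s) x) ^ 2 ≤ N

theorem Sol.ld (hS : Sol κ L C0 D ρ) {t : ℝ} (ht : 0 < t) (hg : Good κ L D ρ t) :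
    LD L ρ (Aop κ L D (ρ t)) t := by
  refine ⟨?_, hS.cA ht, ?_, hS.ev t ht⟩
  · filter_upwards [lt_mem_nhds ht] with s hs using hS.ct hs
  · obtain ⟨N, hN⟩ := hg
    obtain ⟨δ, hδ, hb⟩ := Metric.eventually_nhds_iff_ball.1 (hN.and (lt_mem_nhds ht))
    refine ⟨N, Metric.eventually_nhds_iff_ball.2 ⟨δ, hδ, fun s hs => ?_⟩⟩
    have htb : t ∈ Metric.ball t δ := Metric.mem_ball_self hδ
    have hconv := (convex_ball t δ).ordConnected
    rcases le_total s t with h | h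
    · have := hS.lip (hb s hs).2 h fun r hr => (hb r (hconv.out hs htb hr)).1
      calc _ = ∫ x in box L d, (ρ t x - ρ s x) ^ 2 := by
            congr 1; funext x; ring
        _ ≤ _ := this
        _ = _ := by ring
    · exact hS.lip ht h fun r hr => (hb r (hconv.out htb hs hr)).1

theorem LD.shift {P : ℝ → (Fin d → ℝ) → ℝ} {P' : (Fin d → ℝ) → ℝ} {t h : ℝ}
    (k : LD L P P' (t + h)) : LD L (fun s => P (s + h)) P' t := by
  have hc : Tendsto (fun s => s + h) (𝓝 t) (𝓝 (t + h)) := by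
    exact (continuous_id.add continuous_const).tendsto t
  obtain ⟨N, hN⟩ := k.lip
  refine ⟨hc.eventually k.ct, k.c', ⟨N, ?_⟩, fun x => (k.der x).comp_add_const t h⟩
  filter_upwards [hc.eventually hN] with s hs
  simpa using hs

theorem gron {φ φ' : ℝ → ℝ} {a t c n : ℝ} (hat : a < t) (hc : 0 ≤ c) (hn : 0 ≤ n)
    (hd : ∀ s ∈ Set.Ioc a t, HasDerivAt φ (φ' s) s)
    (hle : ∀ s ∈ Set.Ioc a t, φ' s ≤ c * φ s + n)
    (h0 : Tendsto φ (𝓝[>] a) (𝓝 (φ a))) :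
    φ t ≤ (φ a + n * (t - a)) * Real.exp (c * (t - a)) := by
  set g : ℝ → ℝ := fun s => φ s * Real.exp (-(c * (s - a))) - n * (s - a) with hg
  have hder : ∀ s ∈ Set.Ioc a t, HasDerivAt g
      ((φ' s - c * φ s) * Real.exp (-(c * (s - a))) - n) s := by
    intro s hs
    have e1 : HasDerivAt (fun s : ℝ => s - a) 1 s := (hasDerivAt_id s).sub_const a
    have e2 : HasDerivAt (fun s : ℝ => Real.exp (-(c * (s - a))))
        (Real.exp (-(c * (s - a))) * (-(c * 1))) s := ((e1.const_mul c).neg).exp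
    have := ((hd s hs).mul e2).sub (e1.const_mul n)
    convert! this using 1
    ring
  have hcont : ContinuousOn g (Set.Icc a t) := by
    intro s hs
    rcases hs.1.eq_or_lt with rfl | h
    · have h1 : ContinuousWithinAt φ (Set.Icc a t) a := by
        have : ContinuousWithinAt φ (Set.Ioi a) a := h0
        exact (continuousWithinAt_Ioi_iff_Ici.1 this).mono Set.Icc_subset_Ici_self
      refine (h1.mul ?_).sub ?_
      · exact Continuous.continuousWithinAt (by fun_prop)
      · exact Continuous.continuousWithinAt (by fun_prop)
    · exact (hder s ⟨h, hs.2⟩).continuousAt.continuousWithinAt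
  have hanti : AntitoneOn g (Set.Icc a t) := by
    refine antitoneOn_of_deriv_nonpos (convex_Icc a t) hcont ?_ ?_
    · intro s hs
      rw [interior_Icc] at hs
      exact (hder s ⟨hs.1, hs.2.le⟩).differentiableAt.differentiableWithinAt
    · intro s hs
      rw [interior_Icc] at hs
      rw [(hder s ⟨hs.1, hs.2.le⟩).deriv]
      have h1 := hle s ⟨hs.1, hs.2.le⟩
      have h2 : Real.exp (-(c * (s - a))) ≤ 1 := by
        rw [Real.exp_le_one_iff]
        have := mul_nonneg hc (sub_nonneg.2 hs.1.le)
        linarith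
      have h3 := Real.exp_pos (-(c * (s - a)))
      nlinarith
  have := hanti (Set.left_mem_Icc.2 hat.le) (Set.right_mem_Icc.2 hat.le) hat.le
  simp only [hg, sub_self, mul_zero, neg_zero, Real.exp_zero, mul_one, sub_zero] at this
  have h4 : φ t * Real.exp (-(c * (t - a))) ≤ φ a + n * (t - a) := by linarith
  rw [Real.exp_neg, ← div_eq_mul_inv, div_le_iff₀ (Real.exp_pos _)] at h4
  exact h4

theorem fatou {ι : Type*} {l : Filter ι} [l.IsCountablyGenerated] [l.NeBot]
    {F : ι → (Fin d → ℝ) → ℝ} {f : (Fin d → ℝ) → ℝ} {C : ℝ}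
    (hF : ∀ᶠ n in l, Continuous (F n)) (hC : ∀ᶠ n in l, ∫ x in box L d, (F n x) ^ 2 ≤ C)
    (hf : Continuous f) (hlim : ∀ x ∈ box L d, Tendsto (fun n => F n x) l (𝓝 (f x))) :
    ∫ x in box L d, (f x) ^ 2 ≤ C := by
  obtain ⟨M, hM⟩ := (box_compact (L := L) (d := d)).exists_bound_of_continuousOn hf.continuousOn
  have h := vitali (L := L) (l := l) (F := fun n x => f x * F n x) (f := fun x => f x * f x)
    (C := M ^ 2 * C) (M0 := M * M) ?_ ?_ ?_ fun x hx => (hlim x hx).const_mul (f x)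
  · have : ∫ x in box L d, f x * f x ≤ (∫ x in box L d, (f x) ^ 2) / 2 + C / 2 := by
      refine le_of_tendsto h ?_
      filter_upwards [hF, hC] with n h1 h2
      calc _ ≤ ∫ x in box L d, ((f x) ^ 2 / 2 + (F n x) ^ 2 / 2) := by
            refine bint_mono (by fun_prop) (by fun_prop) fun x => ?_
            nlinarith [sq_nonneg (f x - F n x)]
        _ ≤ _ := by
            rw [bint_add (by fun_prop) (by fun_prop), integral_div, integral_div]
            linarith
    simp only [← pow_two] at this
    linarith
  · filter_upwards [hF] with n h1
    fun_prop
  · filter_upwards [hF, hC] with n h1 h2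
    calc _ ≤ ∫ x in box L d, (M ^ 2 * (F n x) ^ 2) := by
          refine setIntegral_mono_on (cont_int (by fun_prop)) (cont_int (by fun_prop)) box_meas
            fun x hx => ?_
          rw [mul_pow]
          refine mul_le_mul_of_nonneg_right ?_ (sq_nonneg _)
          rw [← sq_abs]
          exact pow_le_pow_left₀ (abs_nonneg _) (hM x hx) 2
      _ ≤ _ := by
          rw [integral_const_mul]
          exact mul_le_mul_of_nonneg_left h2 (sq_nonneg _)
  · intro x hx
    have := hM x hx
    rw [abs_mul]
    exact mul_le_mul this this (abs_nonneg _) ((abs_nonneg _).trans this)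

end ld

section prop
open Filter Topology
variable {d : ℕ} {L κ C0 : ℝ} {D : (Fin d → ℝ) → ℝ} {ρ : ℝ → (Fin d → ℝ) → ℝ}

theorem box_reg (hL : 0 < L) : box L d ⊆ closure (interior (box L d)) := by
  have hne : (interior (box L d)).Nonempty := by
    unfold box
    rw [← Set.pi_univ_Icc, interior_pi_set Set.finite_univ]
    simp only [interior_Icc]
    exact Set.univ_pi_nonempty_iff.2 fun i => ⟨0, by constructor <;> linarith⟩
  have hc : Convex ℝ (box L d) := convex_Icc _ _
  rw [hc.closure_interior_eq_closure_of_nonempty_interior hne]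
  exact subset_closure

theorem zero_of_int (hL : 0 < L) {f : (Fin d → ℝ) → ℝ} (hf : Continuous f) (h0 : ∀ x, 0 ≤ f x)
    (hi : ∫ x in box L d, f x ≤ 0) : ∀ x ∈ box L d, f x = 0 := by
  have h1 : ∫ x in box L d, f x = 0 := le_antisymm hi (integral_nonneg h0)
  have h2 : f =ᵐ[volume.restrict (box L d)] 0 :=
    (integral_eq_zero_iff_of_nonneg h0 (cont_int hf)).1 h1
  exact Measure.eqOn_of_ae_eq h2 hf.continuousOn continuous_zero.continuousOn (box_reg hL)

theorem be_lip {e : ℝ} (he : 0 < e) (u v : ℝ) : |be e u - be e v| ≤ 2 * |u - v| := by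
  have := Convex.norm_image_sub_le_of_norm_hasDerivWithin_le (f := be e) (f' := be' e) (C := 2)
    (s := Set.univ) (x := v) (y := u) (fun x _ => (be_deriv he x).hasDerivWithinAt)
    (fun x _ => by
      rw [Real.norm_eq_abs, abs_of_nonneg (be'_nn he x)]; exact be'_le he x) convex_univ
    trivial trivial
  simpa using this

theorem be_pos {e : ℝ} (he : 0 < e) (u : ℝ) : 0 ≤ be e u :=
  le_trans (by positivity) (be_ge he u)

theorem be_le {e : ℝ} (he : 0 < e) (u : ℝ) : be e u ≤ 2 * max u 0 + e := by
  rcases le_total u 0 with h | h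
  · rw [max_eq_right h]; linarith [be_neg he h]
  · rw [max_eq_left h, be_flip]
    have := be_neg he (neg_nonpos.2 h)
    linarith

theorem Sol.tend (hS : Sol κ L C0 D ρ) {a : ℝ} (ha : 0 < a) (x : Fin d → ℝ) :
    Tendsto (fun s => ρ s x) (𝓝[>] a) (𝓝 (ρ a x)) :=
  (hS.ev a ha x).continuousAt.tendsto.mono_left nhdsWithin_le_nhds

theorem Sol.sup (hS : Sol κ L C0 D ρ) {a b K : ℝ} (ha : 0 < a)
    (hg : ∀ s ∈ Set.Ioo a b, Good κ L D ρ s) (hK : ∀ x, ρ a x ≤ K) :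
    ∀ t ∈ Set.Ioo a b, ∀ x, ρ t x ≤ K * Real.exp (κ * d * C0 * (t - a)) := by
  intro t ht
  have hL := hS.hD.hL
  have hV : 0 < L ^ d := by positivity
  set C1 := κ * d * C0 with hC1
  have hC1n : 0 ≤ C1 := mul_nonneg (mul_nonneg hS.hκ.le (Nat.cast_nonneg _)) hS.hD.nn
  have hKp : 0 < K := ((hS.sl a ha).pos 0).trans_le (hK 0)
  set y : ℝ → ℝ := fun s => K * Real.exp (C1 * (s - a)) with hy
  have hyp : ∀ s, 0 < y s := fun s => by positivity
  have hyd : ∀ s, HasDerivAt y (C1 * y s) s := by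
    intro s
    have e1 : HasDerivAt (fun s : ℝ => s - a) 1 s := (hasDerivAt_id s).sub_const a
    have e2 : HasDerivAt (fun s : ℝ => Real.exp (C1 * (s - a)))
        (Real.exp (C1 * (s - a)) * (C1 * 1)) s := (e1.const_mul C1).exp
    have := e2.const_mul K
    convert! this using 1
    simp only [hy]; ring
  have hyc : Continuous y := continuous_iff_continuousAt.2 fun s => (hyd s).continuousAt
  have key : ∀ e > 0, ∫ x in box L d, be e (ρ t x - y t)
      ≤ e * L ^ d * Real.exp (2 * C1 * (t - a)) := by
    intro e he
    have bc := (be_C1 he).continuous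
    have bc' := (be'_C1 he).continuous
    have hG := gron (φ := fun s => ∫ x in box L d, be e (ρ s x - y s))
      (φ' := fun s => ∫ x in box L d, be' e (ρ s x - y s) * (Aop κ L D (ρ s) x - C1 * y s))
      (a := a) (t := t) (c := 2 * C1) (n := 0) ht.1 (by positivity) le_rfl ?_ ?_ ?_
    · refine hG.trans ?_
      rw [zero_mul, add_zero]
      refine mul_le_mul_of_nonneg_right ?_ (Real.exp_pos _).le
      rw [← bint_const hL]
      have := hS.ct ha
      refine bint_mono (by fun_prop) (by fun_prop) fun x => be_neg he ?_
      simp only [hy, sub_self, mul_zero, Real.exp_zero, mul_one]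
      linarith [hK x]
    · intro s hs
      have hs0 : 0 < s := ha.trans hs.1
      have l1 := (hS.ld hs0 (hg s ⟨hs.1, hs.2.trans_lt ht.2⟩)).sub
        (LD.num (d := d) hL (hyd s))
      exact (l1.comp (c := 2) (be_deriv he) bc'
        (Eventually.of_forall fun s x => be_lip he _ _)).deriv
    · intro s hs
      have hs0 : 0 < s := ha.trans hs.1
      have c1 := hS.ct hs0
      have c2 := hS.cA hs0
      have h := sup_static hS.hD hS.hκ (hS.sl s hs0) he (hyp s).le
      rw [bint_add (by fun_prop) (by fun_prop), integral_const_mul, integral_const_mul] at h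
      have e1 : ∫ x in box L d, be' e (ρ s x - y s) * (Aop κ L D (ρ s) x - C1 * y s)
          = (∫ x in box L d, be' e (ρ s x - y s) * Aop κ L D (ρ s) x)
            - C1 * y s * ∫ x in box L d, be' e (ρ s x - y s) := by
        rw [← integral_const_mul, ← bint_sub (by fun_prop) (by fun_prop)]
        congr 1; funext x; ring
      rw [e1]
      rw [← hC1] at h
      linarith
    · have e1 : ∀ s > 0, ∫ x in box L d, be e (ρ s x - y s)
          = 2 * (1 - y s * L ^ d) + ∫ x in box L d, be e (y s - ρ s x) := by
        intro s hs
        have c1 := hS.ct hs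
        have : ∀ x, be e (ρ s x - y s) = 2 * (ρ s x - y s) + be e (y s - ρ s x) := by
          intro x; rw [be_flip, neg_sub]
        simp_rw [this]
        rw [bint_add (by fun_prop) (by fun_prop), integral_const_mul,
          bint_sub (by fun_prop) (by fun_prop), (hS.sl s hs).mass, bint_const hL]
      rw [e1 a ha]
      have hev : ∀ᶠ s in 𝓝[>] a, 0 < s := by
        filter_upwards [self_mem_nhdsWithin] with s hs using ha.trans hs
      have hyt : Tendsto y (𝓝[>] a) (𝓝 (y a)) := (hyc.tendsto a).mono_left nhdsWithin_le_nhds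
      have hT : Tendsto (fun s => 2 * (1 - y s * L ^ d) + ∫ x in box L d, be e (y s - ρ s x))
          (𝓝[>] a) (𝓝 (2 * (1 - y a * L ^ d) + ∫ x in box L d, be e (y a - ρ a x))) := by
        refine Tendsto.add ?_ ?_
        · exact ((hyt.mul_const _).const_sub 1).const_mul 2
        · refine tendsto_integral_filter_of_dominated_convergence
            (fun _ => 2 * (y a + 1) + e) ?_ ?_ (cont_int continuous_const) ?_
          · filter_upwards [hev] with s hs
            have c1 := hS.ct hs
            exact Continuous.aestronglyMeasurable (by fun_prop)
          · have : ∀ᶠ s in 𝓝[>] a, y s < y a + 1 := hyt.eventually_lt_const (by linarith)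
            filter_upwards [hev, this] with s hs h2
            refine Eventually.of_forall fun x => ?_
            rw [Real.norm_eq_abs, abs_of_nonneg (be_pos he _)]
            refine (be_le he _).trans ?_
            have h3 : max (y s - ρ s x) 0 ≤ y a + 1 :=
              max_le (by linarith [(hS.sl s hs).pos x]) (by linarith [hyp a])
            linarith
          · refine Eventually.of_forall fun x => ?_
            exact (bc.tendsto _).comp (hyt.sub (hS.tend ha x))
      refine hT.congr' ?_
      filter_upwards [hev] with s hs using (e1 s hs).symm
  have ht0 : 0 < t := ha.trans ht.1
  have c1 := hS.ct ht0
  have hz : ∫ x in box L d, 2 * max (ρ t x - y t) 0 ≤ 0 := by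
    set E := L ^ d * Real.exp (2 * C1 * (t - a)) with hE
    have hEp : 0 < E := by positivity
    refine le_of_forall_pos_le_add fun η hη => ?_
    have he : 0 < η / E := by positivity
    have := key (η / E) he
    have bc := (be_C1 he).continuous
    rw [mul_assoc, ← hE, div_mul_cancel₀ _ hEp.ne'] at this
    rw [zero_add]
    refine le_trans ?_ this
    exact bint_mono (by fun_prop) (by fun_prop) fun x => be_ge he _
  have hz2 := zero_of_int hL (f := fun x => 2 * max (ρ t x - y t) 0) (by fun_prop)
    (fun x => by positivity) hz
  intro x
  obtain ⟨z, hzb, hzx⟩ := (hS.sl t ht0).per.to_box hL x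
  rw [← hzx]
  have h5 := hz2 z hzb
  have h6 := le_max_left (ρ t z - y t) 0
  have : ρ t z ≤ y t := by linarith
  exact this

theorem CE_nn (K : ℝ) : 0 ≤ CE d L κ C0 K := by unfold CE; positivity

theorem Sol.step2 (hS : Sol κ L C0 D ρ) {a b K n : ℝ} (ha : 0 < a)
    (hg : ∀ s ∈ Set.Ioo a b, Good κ L D ρ s) (hK : ∀ s ∈ Set.Ico a b, ∀ x, ρ s x ≤ K)
    (hn : ∫ x in box L d, (Aop κ L D (ρ a) x) ^ 2 ≤ n) :
    ∀ t ∈ Set.Ioo a b, ∫ x in box L d, (ρ t x - ρ a x) ^ 2 ≤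
      n * (t - a) ^ 2 * Real.exp (2 * CE d L κ C0 K * (t - a) + 1) := by
  intro t ht
  have hτ : 0 < t - a := sub_pos.2 ht.1
  have hn0 : 0 ≤ n := (integral_nonneg fun x => sq_nonneg _).trans hn
  have ca := hS.ct ha
  have cA := hS.cA ha
  have hab : a < b := ht.1.trans ht.2
  have haK := hK a ⟨le_rfl, hab⟩
  have hbd : ∀ s ∈ Set.Ioo a b, ∀ x, |ρ s x - ρ a x| ≤ K := by
    intro s hs x
    have h1 := (hS.sl s (ha.trans hs.1)).pos x
    have h2 := (hS.sl a ha).pos x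
    have h3 := hK s ⟨hs.1.le, hs.2⟩ x
    have h4 := haK x
    rw [abs_le]; constructor <;> linarith
  set C := CE d L κ C0 K with hC
  have hCn : 0 ≤ C := CE_nn K
  have hG := gron (φ := fun s => ∫ x in box L d, (ρ s x - ρ a x) ^ 2)
    (φ' := fun s => ∫ x in box L d, 2 * (ρ s x - ρ a x) * (Aop κ L D (ρ s) x - 0))
    (a := a) (t := t) (c := 2 * C + 1 / (t - a)) (n := (t - a) * n) ht.1
    (by positivity) (by positivity) ?_ ?_ ?_
  · refine hG.trans (le_of_eq ?_)
    have : (2 * C + 1 / (t - a)) * (t - a) = 2 * C * (t - a) + 1 := by field_simp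
    rw [this]
    simp
    ring
  · intro s hs
    have hs' : s ∈ Set.Ioo a b := ⟨hs.1, hs.2.trans_lt ht.2⟩
    refine (((hS.ld (ha.trans hs.1) (hg s hs')).sub (LD.const ca s)).sq (K := K) ?_).deriv
    filter_upwards [Ioo_mem_nhds hs'.1 hs'.2] with r hr using hbd r hr
  · intro s hs
    have hs0 : 0 < s := ha.trans hs.1
    have c1 := hS.ct hs0
    have c2 := hS.cA hs0
    have h := energy (κ := κ) hS.hD (hS.sl s hs0) (hS.sl a ha) haK
    calc _ ≤ ∫ x in box L d, (2 * ((ρ s x - ρ a x) * (Aop κ L D (ρ s) x - Aop κ L D (ρ a) x))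
            + (1 / (t - a) * (ρ s x - ρ a x) ^ 2 + (t - a) * (Aop κ L D (ρ a) x) ^ 2)) := by
          refine bint_mono (by fun_prop) (by fun_prop) fun x => ?_
          have : 2 * (ρ s x - ρ a x) * Aop κ L D (ρ a) x ≤
              1 / (t - a) * (ρ s x - ρ a x) ^ 2 + (t - a) * (Aop κ L D (ρ a) x) ^ 2 := by
            have h8 : 0 ≤ (1 / (t - a)) * ((ρ s x - ρ a x) - (t - a) * Aop κ L D (ρ a) x) ^ 2 := by
              positivity
            have h9 : (1 / (t - a)) * ((ρ s x - ρ a x) - (t - a) * Aop κ L D (ρ a) x) ^ 2 =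
              1 / (t - a) * (ρ s x - ρ a x) ^ 2 + (t - a) * (Aop κ L D (ρ a) x) ^ 2
              - 2 * (ρ s x - ρ a x) * Aop κ L D (ρ a) x := by
              field_simp; ring
            linarith
          linarith
      _ ≤ _ := by
          rw [bint_add (by fun_prop) (by fun_prop), bint_add (by fun_prop) (by fun_prop),
            integral_const_mul, integral_const_mul, integral_const_mul]
          have := mul_le_mul_of_nonneg_left hn hτ.le
          rw [add_mul]
          linarith
  · refine tendsto_integral_filter_of_dominated_convergence (fun _ => K ^ 2) ?_ ?_
      (cont_int continuous_const) ?_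
    · filter_upwards [self_mem_nhdsWithin] with s hs
      have c1 := hS.ct (ha.trans hs)
      exact Continuous.aestronglyMeasurable (by fun_prop)
    · filter_upwards [Ioo_mem_nhdsGT hab] with s hs
      refine Eventually.of_forall fun x => ?_
      rw [Real.norm_eq_abs, abs_of_nonneg (sq_nonneg _), ← sq_abs]
      exact pow_le_pow_left₀ (abs_nonneg _) (hbd s hs x) 2
    · refine Eventually.of_forall fun x => ?_
      exact ((hS.tend ha x).sub_const _).pow 2

theorem Sol.step3 (hS : Sol κ L C0 D ρ) {a b K n : ℝ} (ha : 0 < a) (hb1 : b ≤ a + 1)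
    (hg : ∀ s ∈ Set.Ioo a b, Good κ L D ρ s) (hK : ∀ s ∈ Set.Ico a b, ∀ x, ρ s x ≤ K)
    (hn : ∫ x in box L d, (Aop κ L D (ρ a) x) ^ 2 ≤ n) :
    ∀ t ∈ Set.Ioo a b, ∫ x in box L d, (Aop κ L D (ρ t) x) ^ 2 ≤
      n * Real.exp (4 * CE d L κ C0 K + 1) := by
  intro t ht
  have hn0 : 0 ≤ n := (integral_nonneg fun x => sq_nonneg _).trans hn
  have hab : a < b := ht.1.trans ht.2
  have ht0 : 0 < t := ha.trans ht.1
  have hbd : ∀ s ∈ Set.Ico a b, ∀ r ∈ Set.Ico a b, ∀ x, |ρ s x - ρ r x| ≤ K := by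
    intro s hs r hr x
    have h1 := (hS.sl s (ha.trans_le hs.1)).pos x
    have h2 := (hS.sl r (ha.trans_le hr.1)).pos x
    have h3 := hK s hs x
    have h4 := hK r hr x
    rw [abs_le]; constructor <;> linarith
  have h2 := hS.step2 ha hg hK hn
  set C := CE d L κ C0 K with hC
  have hCn : 0 ≤ C := CE_nn K
  have key : ∀ h ∈ Set.Ioo 0 (b - t), ∫ x in box L d, (ρ (t + h) x - ρ t x) ^ 2 ≤
      n * Real.exp (4 * C + 1) * h ^ 2 := by
    intro h hh
    have hG := gron (φ := fun s => ∫ x in box L d, (ρ (s + h) x - ρ s x) ^ 2)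
      (φ' := fun s => ∫ x in box L d, 2 * (ρ (s + h) x - ρ s x) *
        (Aop κ L D (ρ (s + h)) x - Aop κ L D (ρ s) x))
      (a := a) (t := t) (c := 2 * C) (n := 0) ht.1 (by positivity) le_rfl ?_ ?_ ?_
    · refine hG.trans ?_
      have h5 := h2 (a + h) ⟨by linarith [hh.1], by linarith [hh.2, ht.1]⟩
      rw [add_sub_cancel_left] at h5
      rw [zero_mul, add_zero]
      refine (mul_le_mul_of_nonneg_right h5 (Real.exp_pos _).le).trans ?_
      rw [mul_assoc, ← Real.exp_add]
      have h6 : Real.exp (2 * C * h + 1 + 2 * C * (t - a)) ≤ Real.exp (4 * C + 1) := by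
        apply Real.exp_le_exp.2
        have : h + (t - a) ≤ 1 := by linarith [hh.2]
        nlinarith
      have h7 : 0 ≤ n * h ^ 2 := by positivity
      calc _ ≤ n * h ^ 2 * Real.exp (4 * C + 1) := mul_le_mul_of_nonneg_left h6 h7
        _ = _ := by ring
    · intro s hs
      have hs' : s ∈ Set.Ioo a b := ⟨hs.1, hs.2.trans_lt ht.2⟩
      have hsh : s + h ∈ Set.Ioo a b := ⟨by linarith [hs.1, hh.1], by linarith [hs.2, hh.2]⟩
      have l1 := (hS.ld (ha.trans hsh.1) (hg _ hsh)).shift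
      refine ((l1.sub (hS.ld (ha.trans hs.1) (hg s hs'))).sq (K := K) ?_).deriv
      have hc : Tendsto (fun s => s + h) (𝓝 s) (𝓝 (s + h)) :=
        (continuous_id.add continuous_const).tendsto s
      filter_upwards [Ioo_mem_nhds hs'.1 hs'.2, hc.eventually (Ioo_mem_nhds hsh.1 hsh.2)]
        with r hr hr' using hbd _ ⟨hr'.1.le, hr'.2⟩ _ ⟨hr.1.le, hr.2⟩
    · intro s hs
      have hs0 : 0 < s := ha.trans hs.1
      have hsh : 0 < s + h := by linarith [hh.1]
      have := energy (κ := κ) hS.hD (hS.sl (s + h) hsh) (hS.sl s hs0)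
        (hK s ⟨hs.1.le, hs.2.trans_lt ht.2⟩)
      simp_rw [mul_assoc]
      rw [integral_const_mul]
      linarith
    · have hc : Tendsto (fun s => s + h) (𝓝[>] a) (𝓝 (a + h)) :=
        ((continuous_id.add continuous_const).tendsto a).mono_left nhdsWithin_le_nhds
      have hev : ∀ᶠ s in 𝓝[>] a, s ∈ Set.Ioo a t := Ioo_mem_nhdsGT ht.1
      refine tendsto_integral_filter_of_dominated_convergence (fun _ => K ^ 2) ?_ ?_
        (cont_int continuous_const) ?_
      · filter_upwards [hev] with s hs
        have c1 := hS.ct (ha.trans hs.1)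
        have c2 := hS.ct (show 0 < s + h by linarith [hs.1, hh.1])
        exact Continuous.aestronglyMeasurable (by fun_prop)
      · filter_upwards [hev] with s hs
        refine Eventually.of_forall fun x => ?_
        rw [Real.norm_eq_abs, abs_of_nonneg (sq_nonneg _), ← sq_abs]
        exact pow_le_pow_left₀ (abs_nonneg _) (hbd _ ⟨by linarith [hs.1, hh.1],
          by linarith [hs.2, hh.2]⟩ _ ⟨hs.1.le, hs.2.trans ht.2⟩ x) 2
      · refine Eventually.of_forall fun x => ?_
        have h8 := (hS.ev (a + h) (by linarith [hh.1]) x).continuousAt.tendsto.comp hc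
        exact (h8.sub (hS.tend ha x)).pow 2
  have hev : ∀ᶠ h in 𝓝[>] (0:ℝ), h ∈ Set.Ioo 0 (b - t) := Ioo_mem_nhdsGT (sub_pos.2 ht.2)
  refine fatou (l := 𝓝[>] (0:ℝ)) (F := fun h x => h⁻¹ • (ρ (t + h) x - ρ t x)) ?_ ?_
    (hS.cA ht0) ?_
  · filter_upwards [hev] with h hh
    have c1 := hS.ct (show 0 < t + h by linarith [hh.1])
    have c2 := hS.ct ht0
    fun_prop
  · filter_upwards [hev] with h hh
    have := hh.1
    simp only [smul_eq_mul, mul_pow]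
    rw [integral_const_mul, inv_pow, inv_mul_le_iff₀ (by positivity), mul_comm (h ^ 2)]
    exact key h hh
  · intro x _
    exact (hS.ev t ht0 x).tendsto_slope_zero_right

end prop

section baire
open Filter Topology
variable {d : ℕ} {L κ C0 : ℝ} {D : (Fin d → ℝ) → ℝ} {ρ : ℝ → (Fin d → ℝ) → ℝ}

theorem dir_deriv {f : (Fin d → ℝ) → ℝ} (hf : ContDiff ℝ 1 f) (i : Fin d) (x : Fin d → ℝ) (h : ℝ) :
    HasDerivAt (fun h : ℝ => f (x + h • (Pi.single i 1 : Fin d → ℝ)))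
      (pd i f (x + h • (Pi.single i 1 : Fin d → ℝ))) h := by
  have h1 := (hf.differentiable one_ne_zero (x + h • (Pi.single i 1 : Fin d → ℝ))).hasFDerivAt
  have h2 : HasDerivAt (fun h : ℝ => x + h • (Pi.single i 1 : Fin d → ℝ))
      (Pi.single i 1 : Fin d → ℝ) h := by
    simpa using ((hasDerivAt_id h).smul_const (Pi.single i 1 : Fin d → ℝ)).const_add x
  exact h1.comp_hasDerivAt h h2

theorem mvt_dir {f : (Fin d → ℝ) → ℝ} (hf : ContDiff ℝ 1 f) (i : Fin d) {M : ℝ}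
    (hM : ∀ x, |pd i f x| ≤ M) (x : Fin d → ℝ) (h : ℝ) :
    |f (x + h • (Pi.single i 1 : Fin d → ℝ)) - f x| ≤ M * |h| := by
  have := Convex.norm_image_sub_le_of_norm_hasDerivWithin_le (C := M)
    (s := Set.univ) (x := (0:ℝ)) (y := h) (fun r _ => (dir_deriv hf i x r).hasDerivWithinAt)
    (fun r _ => hM _) convex_univ trivial trivial
  simpa using this

theorem mvt_conv {f : (Fin d → ℝ) → ℝ} (hf : ContDiff ℝ 1 f) (i : Fin d) {M : ℝ} (x : Fin d → ℝ)
    (hM : ∀ h : ℝ, |f (x + h • (Pi.single i 1 : Fin d → ℝ)) - f x| ≤ M * |h|) :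
    |pd i f x| ≤ M := by
  have h1 := (dir_deriv hf i x 0).tendsto_slope_zero
  simp only [zero_add, zero_smul, add_zero] at h1
  refine le_of_tendsto h1.abs ?_
  filter_upwards [self_mem_nhdsWithin] with h hh
  have hh' : 0 < |h| := abs_pos.2 hh
  rw [smul_eq_mul, abs_mul, abs_inv, inv_mul_le_iff₀ hh', mul_comm]
  exact hM h

/-- quantitative `C²` bound, closed under pointwise limits -/
def Bd (n : ℝ) (f : (Fin d → ℝ) → ℝ) : Prop :=
  ∀ x, f x ≤ n ∧ ∀ (i : Fin d) (h k : ℝ),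
    |f (x + h • (Pi.single i 1 : Fin d → ℝ)) - f x| ≤ n * |h| ∧
    |(f (x + h • (Pi.single i 1 : Fin d → ℝ) + k • (Pi.single i 1 : Fin d → ℝ))
        - f (x + h • (Pi.single i 1 : Fin d → ℝ)))
      - (f (x + k • (Pi.single i 1 : Fin d → ℝ)) - f x)| ≤ n * |k| * |h|

theorem Bd.mono {n m : ℝ} {f : (Fin d → ℝ) → ℝ} (h : Bd n f) (hnm : n ≤ m) : Bd m f := by
  intro x
  refine ⟨(h x).1.trans hnm, fun i a b => ⟨((h x).2 i a b).1.trans ?_, ((h x).2 i a b).2.trans ?_⟩⟩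
  <;> gcongr

theorem shift_C1 {f : (Fin d → ℝ) → ℝ} (hf : ContDiff ℝ 1 f) (v : Fin d → ℝ) :
    ContDiff ℝ 1 (fun y => f (y + v)) := hf.comp (contDiff_id.add contDiff_const)

theorem pd_shift {f : (Fin d → ℝ) → ℝ} (v : Fin d → ℝ) (i : Fin d)
    (x : Fin d → ℝ) : pd i (fun y => f (y + v)) x = pd i f (x + v) := by
  unfold pd
  rw [fderiv_comp_add_right]

theorem Sl.Bd {f : (Fin d → ℝ) → ℝ} (hL : 0 < L) (hf : Sl L f) : ∃ n : ℕ, Bd n f := by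
  obtain ⟨C, hC0, hC⟩ := hf.per.bdd hL hf.C2.continuous
  choose C1 h10 h1 using fun i => (hf.per.pd i).bdd hL (pd_C1 hf.C2 i).continuous
  choose C2 h20 h2 using fun i => ((hf.per.pd i).pd i).bdd hL (pd_cont (pd_C1 hf.C2 i) i)
  obtain ⟨n, hn⟩ := exists_nat_ge (C + ∑ i, (C1 i + C2 i))
  have hle : ∀ i, C1 i + C2 i ≤ ∑ i, (C1 i + C2 i) := fun i =>
    Finset.single_le_sum (f := fun i => C1 i + C2 i)
      (fun j _ => add_nonneg (h10 j) (h20 j)) (Finset.mem_univ i)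
  have hs : 0 ≤ ∑ i, (C1 i + C2 i) := Finset.sum_nonneg fun j _ => add_nonneg (h10 j) (h20 j)
  have b1 : ∀ i x, |pd i f x| ≤ n := fun i x => by linarith [h1 i x, hle i, h20 i]
  have b2 : ∀ i x, |pd i (pd i f) x| ≤ n := fun i x => by linarith [h2 i x, hle i, h10 i]
  refine ⟨n, fun x => ⟨?_, fun i h k => ⟨mvt_dir hf.C1 i (b1 i) x h, ?_⟩⟩⟩
  · linarith [le_abs_self (f x), hC x]
  · have hg : ContDiff ℝ 1 (fun y => f (y + k • (Pi.single i 1 : Fin d → ℝ)) - f y) :=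
      (shift_C1 hf.C1 _).sub hf.C1
    refine mvt_dir hg i (M := n * |k|) (fun y => ?_) x h
    rw [pd_sub (shift_C1 hf.C1 _) hf.C1, pd_shift]
    exact mvt_dir (pd_C1 hf.C2 i) i (b2 i) y k

theorem Bd.b1 {n : ℝ} {f : (Fin d → ℝ) → ℝ} (hb : Bd n f) (hf : Sl L f) (i : Fin d)
    (x : Fin d → ℝ) : |pd i f x| ≤ n :=
  mvt_conv hf.C1 i x fun h => ((hb x).2 i h 0).1

theorem Bd.b2 {n : ℝ} {f : (Fin d → ℝ) → ℝ} (hb : Bd n f) (hf : Sl L f) (i : Fin d)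
    (x : Fin d → ℝ) : |pd i (pd i f) x| ≤ n := by
  refine mvt_conv (pd_C1 hf.C2 i) i x fun k => ?_
  rw [← pd_shift, ← pd_sub (shift_C1 hf.C1 _) hf.C1]
  exact mvt_conv ((shift_C1 hf.C1 _).sub hf.C1) i x fun h => ((hb x).2 i h k).2

theorem Aop_bound (hD : Po L C0 D) (hκ : 0 < κ) {f : (Fin d → ℝ) → ℝ} (hf : Sl L f) {n : ℝ}
    (hb : Bd n f) (x : Fin d → ℝ) : |Aop κ L D f x| ≤ d * (κ * (2 * n * C0) + n) := by
  rw [Aop_eq hD hf]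
  refine (Finset.abs_sum_le_sum_abs _ _).trans ?_
  have : ∀ i ∈ (Finset.univ : Finset (Fin d)),
      |κ * pd i (fun y => f y * conv L (pd i D) f y) x + pd i (pd i f) x|
        ≤ κ * (2 * n * C0) + n := by
    intro i _
    rw [pd_mul hf.C1 (hD.B1 hf i)]
    have p0 := hf.pos x
    have p1 := (hb x).1
    refine (abs_add_le _ _).trans (add_le_add ?_ (hb.b2 hf i x))
    rw [abs_mul, abs_of_pos hκ]
    refine mul_le_mul_of_nonneg_left ?_ hκ.le
    refine (abs_add_le _ _).trans ?_
    rw [abs_mul, abs_mul, abs_of_pos p0]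
    have q1 := mul_le_mul p1 (hD.dBd hf i x) (abs_nonneg _) (p0.le.trans p1)
    have q2 := mul_le_mul (hb.b1 hf i x) (hD.Bd hf i x) (abs_nonneg _) (p0.le.trans p1)
    linarith
  refine (Finset.sum_le_sum this).trans (le_of_eq ?_)
  rw [Finset.sum_const, Finset.card_univ, Fintype.card_fin, nsmul_eq_mul]

theorem Sol.A2 (hS : Sol κ L C0 D ρ) {t n : ℝ} (ht : 0 < t) (hb : Bd n (ρ t)) :
    ∫ x in box L d, (Aop κ L D (ρ t) x) ^ 2 ≤ (d * (κ * (2 * n * C0) + n)) ^ 2 * L ^ d := by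
  have c := hS.cA ht
  rw [← bint_const hS.hD.hL]
  refine bint_mono (by fun_prop) (by fun_prop) fun x => ?_
  rw [← sq_abs]
  exact pow_le_pow_left₀ (abs_nonneg _) (Aop_bound hS.hD hS.hκ (hS.sl t ht) hb x) 2

theorem Sol.propag (hS : Sol κ L C0 D ρ) {a b m n : ℝ} (ha : 0 < a) (hb1 : b ≤ a + 1)
    (hg : ∀ s ∈ Set.Ioo a b, Good κ L D ρ s) (hm : ∀ x, ρ a x ≤ m)
    (hn : ∫ x in box L d, (Aop κ L D (ρ a) x) ^ 2 ≤ n) :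
    ∀ t ∈ Set.Ioo a b, ∫ x in box L d, (Aop κ L D (ρ t) x) ^ 2 ≤
      n * Real.exp (4 * CE d L κ C0 (m * Real.exp (κ * d * C0)) + 1) := by
  have hC1n : 0 ≤ κ * d * C0 := mul_nonneg (mul_nonneg hS.hκ.le (Nat.cast_nonneg _)) hS.hD.nn
  have hKp : 0 < m := ((hS.sl a ha).pos 0).trans_le (hm 0)
  refine hS.step3 ha hb1 hg ?_ hn
  intro s hs x
  rcases hs.1.eq_or_lt with rfl | h
  · refine (hm x).trans ?_
    have := Real.one_le_exp hC1n
    nlinarith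
  · refine (hS.sup ha hg hm s ⟨h, hs.2⟩ x).trans ?_
    refine mul_le_mul_of_nonneg_left ?_ hKp.le
    apply Real.exp_le_exp.2
    have := hs.2
    nlinarith

theorem good_open : IsOpen {t | Good κ L D ρ t} := by
  rw [isOpen_iff_mem_nhds]
  rintro t ⟨N, hN⟩
  filter_upwards [eventually_eventually_nhds.2 hN] with s hs
  exact ⟨N, hs⟩

theorem Sol.good (hS : Sol κ L C0 D ρ) : ∀ t > 0, Good κ L D ρ t := by
  by_contra hcon
  push Not at hcon
  obtain ⟨t1, ht1, ht1'⟩ := hcon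
  let T : Set ℝ := Set.Ioi 0 ∩ {t | Good κ L D ρ t}ᶜ
  have hTl : IsLocallyClosed T :=
    isOpen_Ioi.isLocallyClosed.inter good_open.isClosed_compl.isLocallyClosed
  have : LocallyCompactSpace T := hTl.locallyCompactSpace
  have : Nonempty T := ⟨⟨t1, ht1, ht1'⟩⟩
  have hL := hS.hD.hL
  have hcx : ∀ x, Continuous (fun t : T => ρ t.1 x) := by
    intro x
    have : ContinuousOn (fun s => ρ s x) (Set.Ioi 0) := fun s hs =>
      (hS.ev s hs x).continuousAt.continuousWithinAt
    exact this.comp_continuous continuous_subtype_val fun t => t.2.1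
  have hcl : ∀ n : ℕ, IsClosed {t : T | Bd (n:ℝ) (ρ t.1)} := by
    intro n
    unfold Bd
    simp only [Set.ofPred_forall, Set.ofPred_and]
    refine isClosed_iInter fun x => (isClosed_le (hcx x) continuous_const).inter ?_
    refine isClosed_iInter fun i => isClosed_iInter fun h => isClosed_iInter fun k => ?_
    refine IsClosed.inter (isClosed_le ?_ continuous_const) (isClosed_le ?_ continuous_const)
    · exact ((hcx _).sub (hcx _)).abs
    · exact (((hcx _).sub (hcx _)).sub ((hcx _).sub (hcx _))).abs
  have hun : ⋃ n : ℕ, {t : T | Bd (n:ℝ) (ρ t.1)} = Set.univ := by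
    rw [Set.eq_univ_iff_forall]
    intro t
    obtain ⟨n, hn⟩ := (hS.sl t.1 t.2.1).Bd hL
    exact Set.mem_iUnion.2 ⟨n, hn⟩
  obtain ⟨n, ⟨t0, ht0⟩⟩ := nonempty_interior_of_iUnion_of_closed hcl hun
  rw [mem_interior_iff_mem_nhds, nhds_subtype_eq_comap, mem_comap] at ht0
  obtain ⟨U, hU, hUE⟩ := ht0
  obtain ⟨δ', hδ', hball⟩ := Metric.mem_nhds_iff.1 hU
  have ht0p : 0 < t0.1 := t0.2.1
  obtain ⟨δ, hδ, hδ1, hδ2, hδ3⟩ : ∃ δ > 0, δ < δ' ∧ δ < t0.1 ∧ δ ≤ 1 / 4 := by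
    refine ⟨min (min δ' t0.1) (1 / 2) / 2, by positivity, ?_, ?_, ?_⟩
    · have := min_le_left (min δ' t0.1) (1 / 2)
      have := min_le_left δ' t0.1
      linarith
    · have := min_le_left (min δ' t0.1) (1 / 2)
      have := min_le_right δ' t0.1
      linarith
    · have := min_le_right (min δ' t0.1) (1 / 2)
      linarith
  have hE : ∀ t, ¬ Good κ L D ρ t → t ∈ Set.Icc (t0.1 - δ) (t0.1 + δ) → Bd (n:ℝ) (ρ t) := by
    intro t ht hti
    have htp : 0 < t := by linarith [hti.1]
    have : (⟨t, htp, ht⟩ : T) ∈ Subtype.val ⁻¹' U := by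
      apply hball
      rw [Metric.mem_ball, Real.dist_eq, abs_lt]
      constructor <;> linarith [hti.1, hti.2]
    exact hUE this
  set a1 := t0.1 - δ with ha1
  have ha1p : 0 < a1 := by linarith
  obtain ⟨n1, hn1⟩ := (hS.sl a1 ha1p).Bd hL
  set m : ℝ := max n n1 with hm
  set N0 : ℝ := (d * (κ * (2 * m * C0) + m)) ^ 2 * L ^ d with hN0
  have hN0n : 0 ≤ N0 := by positivity
  set X : ℝ := Real.exp (4 * CE d L κ C0 (m * Real.exp (κ * d * C0)) + 1) with hX
  have hX1 : 1 ≤ X := by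
    have h9 : 0 ≤ CE d L κ C0 (m * Real.exp (κ * d * C0)) := CE_nn _
    exact Real.one_le_exp (by linarith)
  refine t0.2.2 ⟨N0 * X, ?_⟩
  filter_upwards [Ioo_mem_nhds (show a1 < t0.1 by linarith) (show t0.1 < t0.1 + δ by linarith)]
    with t ht
  have htp : 0 < t := ha1p.trans ht.1
  by_cases hgt : Good κ L D ρ t
  · have hSc : IsCompact ({a1} ∪ ({t | Good κ L D ρ t}ᶜ ∩ Set.Icc a1 t)) :=
      isCompact_singleton.union (isCompact_Icc.inter_left good_open.isClosed_compl)
    have hne : ({a1} ∪ ({t | Good κ L D ρ t}ᶜ ∩ Set.Icc a1 t)).Nonempty := ⟨a1, Or.inl rfl⟩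
    obtain ⟨a, haS, hamax⟩ := hSc.exists_isGreatest hne
    have haa1 : a1 ≤ a := hamax (Or.inl rfl)
    have hap : 0 < a := ha1p.trans_le haa1
    have hat : a < t := by
      rcases haS with h | h
      · rw [Set.mem_singleton_iff.1 h]; exact ht.1
      · refine lt_of_le_of_ne h.2.2 ?_
        rintro rfl
        exact h.1 hgt
    have hBd : Bd m (ρ a) := by
      rcases haS with h | h
      · rw [Set.mem_singleton_iff.1 h]; exact hn1.mono (le_max_right _ _)
      · exact (hE a h.1 ⟨haa1, hat.le.trans ht.2.le⟩).mono (le_max_left _ _)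
    obtain ⟨ε, hε, hεb⟩ := Metric.isOpen_iff.1 good_open t hgt
    refine hS.propag (a := a) (b := min (t + ε) (a + 1)) hap (min_le_right _ _) ?_
      (fun x => (hBd x).1) (hS.A2 hap hBd) t ⟨hat, lt_min (by linarith) (by linarith [ht.2])⟩
    intro s hs
    rcases le_or_gt s t with h | h
    · by_contra hng
      exact absurd (hamax (Or.inr ⟨hng, haa1.trans hs.1.le, h⟩)) (not_le.2 hs.1)
    · apply hεb
      have := hs.2.trans_le (min_le_left _ _)
      rw [Metric.mem_ball, Real.dist_eq, abs_lt]
      constructor <;> linarith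
  · have hb := (hE t hgt ⟨ht.1.le, ht.2.le⟩).mono (le_max_left (n:ℝ) n1)
    refine (hS.A2 htp hb).trans ?_
    rw [← hm, ← hN0]
    nlinarith

end baire

section final
open Filter Topology
variable {d : ℕ} {L κ C0 : ℝ} {D : (Fin d → ℝ) → ℝ} {ρ : ℝ → (Fin d → ℝ) → ℝ}

theorem LD.mulr {P : ℝ → (Fin d → ℝ) → ℝ} {P' g : (Fin d → ℝ) → ℝ} {t : ℝ} (h : LD L P P' t)
    (hg : Continuous g) : LD L (fun s x => P s x * g x) (fun x => P' x * g x) t := by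
  obtain ⟨N, hN⟩ := h.lip
  obtain ⟨M, hM⟩ := (box_compact (L := L) (d := d)).exists_bound_of_continuousOn hg.continuousOn
  have h0 := h.ct.self_of_nhds
  refine ⟨?_, h.c'.mul hg, ⟨M ^ 2 * N, ?_⟩, fun x => (h.der x).mul_const _⟩
  · filter_upwards [h.ct] with s h1 using h1.mul hg
  · filter_upwards [h.ct, hN] with s h1 h2
    calc _ ≤ ∫ x in box L d, (M ^ 2 * (P s x - P t x) ^ 2) := by
          refine setIntegral_mono_on (cont_int (by fun_prop)) (cont_int (by fun_prop)) box_meas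
            fun x hx => ?_
          rw [← sub_mul, mul_pow, mul_comm]
          refine mul_le_mul_of_nonneg_right ?_ (sq_nonneg _)
          rw [← sq_abs]
          exact pow_le_pow_left₀ (abs_nonneg _) (hM x hx) 2
      _ ≤ _ := by
          rw [integral_const_mul, mul_assoc]
          exact mul_le_mul_of_nonneg_left h2 (sq_nonneg _)

theorem kl_lo {u v : ℝ} (hu : 0 < u) (hv : 0 < v) :
    0 ≤ u * Real.log u - v * Real.log v - (u - v) * (Real.log v + 1) := by
  have h := Real.log_le_sub_one_of_pos (div_pos hv hu)
  rw [Real.log_div hv.ne' hu.ne'] at h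
  have h2 := mul_le_mul_of_nonneg_left h hu.le
  have h3 : u * (v / u - 1) = v - u := by field_simp
  rw [h3] at h2
  nlinarith

theorem kl_hi {u v : ℝ} (hu : 0 < u) (hv : 0 < v) :
    u * Real.log u - v * Real.log v - (u - v) * (Real.log v + 1) ≤ (u - v) ^ 2 / v := by
  have h := Real.log_le_sub_one_of_pos (div_pos hu hv)
  rw [Real.log_div hu.ne' hv.ne'] at h
  have h2 := mul_le_mul_of_nonneg_left h hu.le
  have h3 : (u - v) ^ 2 / v = u * (u / v - 1) - (u - v) := by field_simp
  rw [h3]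
  nlinarith

theorem Sol.ent (hS : Sol κ L C0 D ρ) {t : ℝ} (ht : 0 < t) :
    HasDerivAt (fun s => relEnt L (ρ s))
      (∫ x in box L d, Aop κ L D (ρ t) x * Real.log (ρ t x)) t := by
  have hL := hS.hD.hL
  have hld := hS.ld ht (hS.good t ht)
  have c0 := hS.ct ht
  have p0 := (hS.sl t ht).pos
  have cl : ∀ s > 0, Continuous (fun x => Real.log (ρ s x)) := fun s hs =>
    (hS.ct hs).log fun x => ((hS.sl s hs).pos x).ne'
  have cl0 := cl t ht
  have hG := (hld.mulr cl0).deriv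
  set R : ℝ → ℝ := fun s => ∫ x in box L d, (ρ s x * Real.log (ρ s x) - ρ t x * Real.log (ρ t x)
    - (ρ s x - ρ t x) * (Real.log (ρ t x) + 1)) with hR
  obtain ⟨c, hc0, hc⟩ : ∃ c > 0, ∀ x ∈ box L d, c ≤ ρ t x := by
    have hne : (box L d).Nonempty := ⟨0, by
      unfold box; rw [Set.mem_Icc, Pi.le_def, Pi.le_def]
      constructor <;> intro i <;> simp <;> linarith⟩
    obtain ⟨x0, _, hx0⟩ := box_compact.exists_isMinOn hne c0.continuousOn
    exact ⟨ρ t x0, p0 x0, fun x hx => hx0 hx⟩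
  have hRt : R t = 0 := by simp [hR]
  have hRd : HasDerivAt R 0 t := by
    rw [hasDerivAt_iff_isLittleO]
    simp only [hRt, sub_zero, smul_zero]
    refine Asymptotics.IsBigO.trans_isLittleO (g := fun s => ‖s - t‖ ^ 2) ?_
      (Asymptotics.isLittleO_pow_sub_sub t one_lt_two)
    obtain ⟨N, hN⟩ := hld.lip
    refine Asymptotics.IsBigO.of_bound (c⁻¹ * N) ?_
    filter_upwards [hN, lt_mem_nhds ht] with s hs hs0
    have c1 := hS.ct hs0
    have cl1 := cl s hs0
    have p1 := (hS.sl s hs0).pos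
    have h1 : 0 ≤ R s := integral_nonneg fun x => kl_lo (p1 x) (p0 x)
    rw [Real.norm_eq_abs, abs_of_nonneg h1, Real.norm_eq_abs, abs_of_nonneg (sq_nonneg _),
      Real.norm_eq_abs, sq_abs]
    calc R s ≤ ∫ x in box L d, c⁻¹ * (ρ s x - ρ t x) ^ 2 := by
          refine setIntegral_mono_on (cont_int (by fun_prop)) (cont_int (by fun_prop)) box_meas
            fun x hx => ?_
          refine (kl_hi (p1 x) (p0 x)).trans ?_
          rw [div_eq_inv_mul]
          refine mul_le_mul_of_nonneg_right ?_ (sq_nonneg _)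
          exact inv_anti₀ hc0 (hc x hx)
      _ ≤ _ := by
          rw [integral_const_mul, mul_assoc]
          exact mul_le_mul_of_nonneg_left hs (inv_pos.2 hc0).le
  have hsum := (hG.add hRd).add_const (Real.log (L ^ d))
  rw [add_zero] at hsum
  refine hsum.congr_of_eventuallyEq ?_
  filter_upwards [lt_mem_nhds ht] with s hs0
  have c1 := hS.ct hs0
  have cl1 := cl s hs0
  have p1 := (hS.sl s hs0).pos
  have hV : L ^ d ≠ 0 := by positivity
  have m0 := (hS.sl t ht).mass
  have m1 := (hS.sl s hs0).mass
  have e1 : R s = (∫ x in box L d, ρ s x * Real.log (ρ s x))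
      - ∫ x in box L d, ρ s x * Real.log (ρ t x) := by
    have : ∀ x, ρ s x * Real.log (ρ s x) - ρ t x * Real.log (ρ t x)
        - (ρ s x - ρ t x) * (Real.log (ρ t x) + 1)
      = (ρ s x * Real.log (ρ s x) - ρ s x * Real.log (ρ t x)) - (ρ s x - ρ t x) := fun x => by ring
    simp only [hR]
    simp_rw [this]
    rw [bint_sub (by fun_prop) (by fun_prop), bint_sub (by fun_prop) (by fun_prop),
      bint_sub (by fun_prop) (by fun_prop), m0, m1]
    ring
  have e2 : relEnt L (ρ s) = (∫ x in box L d, ρ s x * Real.log (ρ s x)) + Real.log (L ^ d) := by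
    unfold relEnt
    have : ∀ x, ρ s x * Real.log (ρ s x * L ^ d)
      = ρ s x * Real.log (ρ s x) + ρ s x * Real.log (L ^ d) := fun x => by
      rw [Real.log_mul (p1 x).ne' hV, mul_add]
    simp_rw [this]
    rw [bint_add (by fun_prop) (by fun_prop), integral_mul_const, m1, one_mul]
  rw [e2, Pi.add_apply, e1]
  ring

theorem Sol.ident (hS : Sol κ L C0 D ρ) {t : ℝ} (ht : 0 < t) :
    ∫ x in box L d, Aop κ L D (ρ t) x * Real.log (ρ t x) =
      -(∫ x in box L d, (∑ i, (pd i (fun y => Real.log (ρ t y)) x) ^ 2) * ρ t x)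
        + κ * ∫ x in box L d, ρ t x * conv L (lap D) (ρ t) x := by
  have hL := hS.hD.hL
  have hf := hS.sl t ht
  have hD := hS.hD
  have c0 := hS.ct ht
  have hp : ContDiff ℝ 1 (fun y => Real.log (ρ t y)) := hf.C1.log fun x => (hf.pos x).ne'
  have cp := fun i => pd_cont hp i
  have cf := fun i => pd_cont hf.C1 i
  have cB := fun i => (hD.B1 hf i).continuous
  have cdB := fun i => pd_cont (hD.B1 hf i) i
  have cdd := fun i => pd_cont (pd_C1 hD.C2 i) i
  simp_rw [mul_comm (Aop κ L D (ρ t) _)]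
  rw [A_weak hD hf hp (hf.per.comp Real.log)]
  have e1 : ∀ i, ∫ x in box L d, pd i (fun y => Real.log (ρ t y)) x *
        (κ * (ρ t x * conv L (pd i D) (ρ t) x) + pd i (ρ t) x) =
      (∫ x in box L d, (pd i (fun y => Real.log (ρ t y)) x) ^ 2 * ρ t x)
        - κ * ∫ x in box L d, ρ t x * conv L (pd i (pd i D)) (ρ t) x := by
    intro i
    have h1 : ∀ x, pd i (fun y => Real.log (ρ t y)) x = (ρ t x)⁻¹ * pd i (ρ t) x := fun x =>
      pd_comp hf.C1 i x (Real.hasDerivAt_log (hf.pos x).ne')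
    have h2 : ∀ x, pd i (fun y => Real.log (ρ t y)) x *
        (κ * (ρ t x * conv L (pd i D) (ρ t) x) + pd i (ρ t) x) =
        (pd i (fun y => Real.log (ρ t y)) x) ^ 2 * ρ t x
          + κ * (pd i (ρ t) x * conv L (pd i D) (ρ t) x) := by
      intro x
      have := (hf.pos x).ne'
      rw [h1]; field_simp; ring
    simp_rw [h2]
    have c1 := cp i
    have c2 := cf i
    have c3 := cB i
    rw [bint_add (by fun_prop) (by fun_prop), integral_const_mul]
    have h3 := ibp hL hf.per hf.C1 (hD.Bper (f := ρ t) i) (hD.B1 hf i) i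
    simp_rw [conv_pd hL (pd_C1 hD.C2 i) (hD.per.pd i) c0 i] at h3
    rw [h3]
    ring
  simp_rw [e1]
  have hlap : ∀ x, conv L (lap D) (ρ t) x = ∑ i, conv L (pd i (pd i D)) (ρ t) x := by
    intro x
    unfold conv lap
    simp_rw [Finset.sum_mul]
    exact bint_sum (f := fun i y => pd i (pd i D) (x - y) * ρ t y) fun i => by
      have := cdd i
      fun_prop
  have e2 : ∫ x in box L d, ρ t x * conv L (lap D) (ρ t) x
      = ∑ i, ∫ x in box L d, ρ t x * conv L (pd i (pd i D)) (ρ t) x := by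
    simp_rw [hlap, Finset.mul_sum]
    exact bint_sum (f := fun i x => ρ t x * conv L (pd i (pd i D)) (ρ t) x) fun i =>
      c0.mul (conv_cont (cdd i) c0)
  have e3 : ∫ x in box L d, (∑ i, (pd i (fun y => Real.log (ρ t y)) x) ^ 2) * ρ t x
      = ∑ i, ∫ x in box L d, (pd i (fun y => Real.log (ρ t y)) x) ^ 2 * ρ t x := by
    simp_rw [Finset.sum_mul]
    exact bint_sum (f := fun i x => (pd i (fun y => Real.log (ρ t y)) x) ^ 2 * ρ t x) fun i => by
      have := cp i
      fun_prop
  rw [e2, e3, Finset.sum_sub_distrib, ← Finset.mul_sum]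
  ring

theorem Po.ex (hL : 0 < L) (hD : ContDiff ℝ 2 D) (hp : Per L D) : ∃ C0, Po L C0 D := by
  choose C1 h10 h1 using fun i => (hp.pd i).bdd hL (pd_C1 hD i).continuous
  choose C2 h20 h2 using fun i => ((hp.pd i).pd i).bdd hL (pd_cont (pd_C1 hD i) i)
  have hle : ∀ i, C1 i + C2 i ≤ ∑ i, (C1 i + C2 i) := fun i =>
    Finset.single_le_sum (f := fun i => C1 i + C2 i)
      (fun j _ => add_nonneg (h10 j) (h20 j)) (Finset.mem_univ i)
  refine ⟨∑ i, (C1 i + C2 i), hL, hD, hp,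
    Finset.sum_nonneg fun j _ => add_nonneg (h10 j) (h20 j), fun i x => ?_, fun i x => ?_⟩
  · linarith [h1 i x, hle i, h20 i]
  · linarith [h2 i x, hle i, h10 i]

end final

/-- Entropy dissipation identity: along a classical solution of the homogeneous
McKean--Vlasov equation the relative entropy is differentiable in time with
`d/dt H(ρ(t)|ρ∞) = -∫ |∇ log ρ|² ρ dx + κ ∫ ρ (ΔD ⋆ ρ) dx`. -/
theorem homogeneous_mckean_vlasov_entropy_dissipation
    {d : ℕ} {L κ : ℝ} (hL : 0 < L) (hκ : 0 < κ)
    (D : (Fin d → ℝ) → ℝ) (hD : ContDiff ℝ 2 D) (hDper : Per L D)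
    (ρ : ℝ → (Fin d → ℝ) → ℝ)
    -- classical solution: `ρ ∈ C¹((0,∞); C²(U))`
    (hreg : ∀ t > (0:ℝ), ContDiff ℝ 2 (ρ t))
    (hper : ∀ t > (0:ℝ), Per L (ρ t))
    -- `ρ(t,·)` is a strictly positive probability density for `t > 0`
    (hpos : ∀ t > (0:ℝ), ∀ x, 0 < ρ t x)
    (hprob : ∀ t > (0:ℝ), ∫ x in box L d, ρ t x = 1)
    -- the McKean--Vlasov equation
    (hPDE : ∀ t > (0:ℝ), ∀ x, HasDerivAt (fun s => ρ s x)
      (κ * divg (fun y i => ρ t y * conv L (pd i D) (ρ t) y) x + lap (ρ t) x) t) :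
    ∀ t > (0:ℝ), HasDerivAt (fun s => relEnt L (ρ s))
      (-(∫ x in box L d, (∑ i, (pd i (fun y => Real.log (ρ t y)) x) ^ 2) * ρ t x)
        + κ * ∫ x in box L d, ρ t x * conv L (lap D) (ρ t) x) t := by
  intro t ht
  obtain ⟨C0, hP⟩ := Po.ex hL hD hDper
  have hS : Sol κ L C0 D ρ :=
    ⟨hP, hκ, fun s hs => ⟨hreg s hs, hper s hs, hpos s hs, hprob s hs⟩, hPDE⟩
  have h := hS.ent ht
  rw [hS.ident ht] at h
  exact h
end
end

section
/- Log-Sobolev inequality on the torus: let U = [−L/2, L/2]^d be the flat torus and let ρ be a strictly positive C¹ probability density on U (more generally ρ ∈ P_ac(U) with √ρ ∈ H¹(U)). Then H(ρ|ρ∞) ≤ (L²/(4π²)) ∫_U |∇_x log ρ(x)|² ρ(x) dx, i.e. ∫_U ρ log(ρ L^d) dx ≤ (L²/(4π²)) ∫_U |∇_x ρ(x)|²/ρ(x) dx. -/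
open MeasureTheory Real

noncomputable section

lemma wirt (f f' : ℝ → ℝ) (hf : ∀ x, HasDerivAt f (f' x) x) (hf' : Continuous f')
    (hp : f 1 = f 0) :
    (∫ x in (0:ℝ)..1, f x ^ 2) - (∫ x in (0:ℝ)..1, f x) ^ 2
      ≤ 1 / (4 * π ^ 2) * ∫ x in (0:ℝ)..1, f' x ^ 2 := by
  have hc : Continuous f := continuous_iff_continuousAt.2 fun x => (hf x).continuousAt
  have h01 : (0:ℝ) < 1 := one_pos
  set F : ℝ → ℂ := fun x => (f x : ℂ) with hF
  set F' : ℝ → ℂ := fun x => (f' x : ℂ) with hF'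
  have hFc : Continuous F := by fun_prop
  have hFc' : Continuous F' := by fun_prop
  have hm : ∀ G : ℝ → ℂ, Continuous G → MemLp G 2 (volume.restrict (Set.Ioc 0 1)) := by
    intro G hG
    obtain ⟨C, hC⟩ := (isCompact_Icc (a := (0:ℝ)) (b := 1)).exists_bound_of_continuousOn
      hG.continuousOn
    refine MemLp.of_bound hG.aestronglyMeasurable C ?_
    filter_upwards [ae_restrict_mem measurableSet_Ioc] with x hx
    exact hC x (Set.Ioc_subset_Icc_self hx)
  have s1 := hasSum_sq_fourierCoeffOn h01 (hm F hFc)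
  have s2 := hasSum_sq_fourierCoeffOn h01 (hm F' hFc')
  have e0 : fourierCoeffOn h01 F 0 = ((∫ x in (0:ℝ)..1, f x : ℝ) : ℂ) := by
    rw [fourierCoeffOn_eq_integral]
    simp [F, intervalIntegral.integral_ofReal]
  have key : ∀ n : ℤ, ‖fourierCoeffOn h01 F n‖ ^ 2
      ≤ (if n = 0 then (∫ x in (0:ℝ)..1, f x) ^ 2 else 0)
        + 1 / (4 * π ^ 2) * ‖fourierCoeffOn h01 F' n‖ ^ 2 := by
    intro n
    by_cases hn : n = 0
    · subst hn
      rw [e0]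
      simp only [Complex.norm_real, norm_eq_abs, sq_abs, if_true]
      have : 0 ≤ 1 / (4 * π ^ 2) * ‖fourierCoeffOn h01 F' 0‖ ^ 2 := by positivity
      linarith
    · have := fourierCoeffOn_of_hasDerivAt h01 hn (f := F) (f' := F')
        (fun x _ => (hf x).ofReal_comp) (hFc'.intervalIntegrable _ _)
      have hFF : F 1 - F 0 = 0 := by simp [F, hp]
      rw [this, hFF]
      simp only [hn, if_false, zero_add, mul_zero, zero_sub, norm_mul, norm_neg, norm_div, norm_one,
        mul_pow, div_pow, one_pow]
      simp only [Complex.norm_ofNat, Complex.norm_real, Complex.norm_I, Complex.norm_intCast,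
        norm_eq_abs, sq_abs, Complex.ofReal_one, Complex.ofReal_zero, sub_zero, norm_one]
      have h1 : (1:ℝ) ≤ (n:ℝ)^2 := by
        have : (1:ℤ) ≤ n^2 := by
          have := Int.one_le_abs hn
          nlinarith [sq_abs n]
        exact_mod_cast this
      simp only [one_pow, one_mul, mul_one]
      apply mul_le_mul_of_nonneg_right _ (by positivity)
      apply one_div_le_one_div_of_le (by positivity)
      nlinarith [pi_pos, sq_nonneg π]
  have s3 := (hasSum_ite_eq (0:ℤ) ((∫ x in (0:ℝ)..1, f x) ^ 2)).add (s2.mul_left (1 / (4 * π ^ 2)))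
  have := hasSum_le key s1 s3
  simp only [F, F', Complex.norm_real, norm_eq_abs, sq_abs, sub_zero, inv_one, one_smul] at this
  linarith

lemma lsi1 (f f' : ℝ → ℝ) (hf : ∀ x, HasDerivAt f (f' x) x) (hf' : Continuous f')
    (hp : Function.Periodic f 1) (hpos : ∀ x, 0 < f x) (h1 : ∫ x in (0:ℝ)..1, f x ^ 2 = 1) :
    ∫ x in (0:ℝ)..1, f x ^ 2 * log (f x) ≤ 1 / (2 * π ^ 2) * ∫ x in (0:ℝ)..1, f' x ^ 2 := by
  have hc : Continuous f := continuous_iff_continuousAt.2 fun x => (hf x).continuousAt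
  have hp' : Function.Periodic f' 1 := by
    intro x
    have h2 : HasDerivAt (fun y => f (y + 1)) (f' (x + 1)) x := (hf (x+1)).comp_add_const x 1
    have : (fun y => f (y + 1)) = f := funext hp
    rw [this] at h2
    exact h2.unique (hf x)
  have W := wirt f f' hf hf' (by simpa using hp 0)
  rw [h1] at W
  set m := ∫ x in (0:ℝ)..1, f x with hm
  set D := ∫ x in (0:ℝ)..1, f' x ^ 2 with hD
  have hD0 : 0 ≤ D := intervalIntegral.integral_nonneg zero_le_one fun x _ => sq_nonneg _
  have hm0 : 0 ≤ m := intervalIntegral.integral_nonneg zero_le_one fun x _ => (hpos x).le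
  have ii : ∀ {g : ℝ → ℝ}, Continuous g → IntervalIntegrable g volume 0 1 :=
    fun hg => hg.intervalIntegrable _ _
  -- m ≤ 1
  have hA : 0 ≤ 1 - m ^ 2 := by
    have : 0 ≤ ∫ x in (0:ℝ)..1, (f x - m) ^ 2 :=
      intervalIntegral.integral_nonneg zero_le_one fun x _ => sq_nonneg _
    have e : ∫ x in (0:ℝ)..1, (f x - m) ^ 2 = 1 - m ^ 2 := by
      have : ∀ x, (f x - m) ^ 2 = f x ^ 2 - (2 * m) * f x + m ^ 2 := fun x => by ring
      simp_rw [this]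
      rw [intervalIntegral.integral_add (ii (by fun_prop)) (ii (by fun_prop)),
        intervalIntegral.integral_sub (ii (by fun_prop)) (ii (by fun_prop)),
        intervalIntegral.integral_const_mul, h1, ← hm]
      simp; ring
    linarith
  -- sup bound
  have S : ∀ x, f x - m ≤ 1 / 2 + D / 24 := by
    intro x
    have ibp := intervalIntegral.integral_mul_deriv_eq_deriv_mul (a := 0) (b := 1)
      (u := fun y : ℝ => y - 1/2) (u' := fun _ => 1) (v := fun y => f (x + y))
      (v' := fun y => f' (x + y))
      (fun y _ => (hasDerivAt_id y).sub_const _)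
      (fun y _ => (hf (x + y)).comp_const_add x y)
      (ii (by fun_prop)) (ii (by fun_prop))
    have p1 : ∫ y in (0:ℝ)..1, f (x + y) = m := by
      rw [intervalIntegral.integral_comp_add_left]
      have := hp.intervalIntegral_add_eq x 0
      simpa using this
    have p2 : ∫ y in (0:ℝ)..1, f' (x + y) ^ 2 = D := by
      rw [intervalIntegral.integral_comp_add_left (fun z => f' z ^ 2)]
      have hq : Function.Periodic (fun z => f' z ^ 2) 1 := fun z => by simp [hp' z]
      have := hq.intervalIntegral_add_eq x 0
      simpa using this
    simp only [one_mul, p1, hp x, add_zero] at ibp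
    have q : ∫ y in (0:ℝ)..1, (y - 1/2) * f' (x + y)
        ≤ ∫ y in (0:ℝ)..1, (6 * (y - 1/2) ^ 2 + 1 / 24 * f' (x + y) ^ 2) := by
      apply intervalIntegral.integral_mono_on zero_le_one (ii (by fun_prop)) (ii (by fun_prop))
      intro y _
      nlinarith [sq_nonneg (12 * (y - 1/2) - f' (x + y))]
    rw [intervalIntegral.integral_add (ii (by fun_prop)) (ii (by fun_prop)),
      intervalIntegral.integral_const_mul, intervalIntegral.integral_const_mul, p2,
      intervalIntegral.integral_comp_sub_right (fun y => y ^ 2)] at q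
    norm_num [integral_pow] at q
    rw [ibp] at q
    linarith
  -- third moment
  have K : ∫ x in (0:ℝ)..1, f x ^ 3 ≤ 3 * m - 2 * m ^ 3 + (1 - m ^ 2) * (1 / 2 + D / 24) := by
    have : ∫ x in (0:ℝ)..1, f x ^ 3 ≤ ∫ x in (0:ℝ)..1,
        ((3 * m + (1 / 2 + D / 24)) * f x ^ 2 + (m ^ 3 + m ^ 2 * (1 / 2 + D / 24))
          - (3 * m ^ 2 + 2 * m * (1 / 2 + D / 24)) * f x) := by
      apply intervalIntegral.integral_mono_on zero_le_one (ii (by fun_prop)) (ii (by fun_prop))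
      intro y _
      nlinarith [mul_le_mul_of_nonneg_left (S y) (sq_nonneg (f y - m))]
    rw [intervalIntegral.integral_sub (ii (by fun_prop)) (ii (by fun_prop)),
      intervalIntegral.integral_add (ii (by fun_prop)) (ii (by fun_prop)),
      intervalIntegral.integral_const_mul, intervalIntegral.integral_const_mul, h1, ← hm] at this
    simp at this
    nlinarith
  set B := 1 / (4 * π ^ 2) * D with hB
  have hB0 : 0 ≤ B := by positivity
  have hDB : D = 4 * π ^ 2 * B := by rw [hB]; field_simp
  have hpi : π ^ 2 < 12 := by nlinarith [pi_lt_d2, pi_pos]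
  have hDB2 : D ≤ 48 * B := by rw [hDB]; nlinarith
  have K2 : ∫ x in (0:ℝ)..1, f x ^ 3 ≤ exp (2 * B) := by
    have e := quadratic_le_exp_of_nonneg (x := 2 * B) (by positivity)
    have hmA : m ≤ 1 - (1 - m ^ 2) / 2 := by nlinarith [sq_nonneg (m - 1)]
    have t1 : m * (1 + 2 * (1 - m^2)) ≤ (1 - (1 - m ^ 2) / 2) * (1 + 2 * (1 - m^2)) :=
      mul_le_mul_of_nonneg_right hmA (by linarith)
    have t2 : (1 - m ^ 2) * D ≤ B * (48 * B) := mul_le_mul W hDB2 hD0 hB0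
    nlinarith [sq_nonneg (1 - m^2)]
  have fin : ∫ x in (0:ℝ)..1, f x ^ 2 * log (f x) ≤
      ∫ x in (0:ℝ)..1, (exp (-(2 * B)) * f x ^ 3 + (2 * B - 1) * f x ^ 2) := by
    have hl : Continuous fun x => log (f x) := hc.log fun x => (hpos x).ne'
    apply intervalIntegral.integral_mono_on zero_le_one (ii (by fun_prop)) (ii (by fun_prop))
    intro y _
    have := log_le_sub_one_of_pos (mul_pos (exp_pos (-(2 * B))) (hpos y))
    rw [log_mul (exp_pos _).ne' (hpos y).ne', log_exp] at this
    nlinarith [mul_le_mul_of_nonneg_left this (sq_nonneg (f y))]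
  rw [intervalIntegral.integral_add (ii (by fun_prop)) (ii (by fun_prop)),
      intervalIntegral.integral_const_mul, intervalIntegral.integral_const_mul, h1] at fin
  have t := mul_le_mul_of_nonneg_left K2 (exp_pos (-(2 * B))).le
  rw [← exp_add] at t
  simp at t
  have : 1 / (2 * π ^ 2) * D = 2 * B := by rw [hB]; field_simp; ring
  rw [this]
  linarith

lemma lsiL {L : ℝ} (hL : 0 < L) (h h' : ℝ → ℝ) (hh : ∀ x, HasDerivAt h (h' x) x)
    (hh' : Continuous h') (hp : Function.Periodic h L) (hpos : ∀ x, 0 < h x) :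
    ∫ x in (-(L/2))..(L/2), h x * log (h x) ≤
      (∫ x in (-(L/2))..(L/2), h x) * log ((∫ x in (-(L/2))..(L/2), h x) / L) +
      L ^ 2 / (4 * π ^ 2) * ∫ x in (-(L/2))..(L/2), h' x ^ 2 / h x := by
  have hc : Continuous h := continuous_iff_continuousAt.2 fun x => (hh x).continuousAt
  set r := ∫ x in (-(L/2))..(L/2), h x with hr
  have hr0 : 0 < r := intervalIntegral.intervalIntegral_pos_of_pos
    (hc.intervalIntegrable _ _) hpos (by linarith)
  have cv : ∀ g : ℝ → ℝ, ∫ x in (0:ℝ)..1, g (L * x - L / 2)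
      = L⁻¹ * ∫ x in (-(L/2))..(L/2), g x := by
    intro g
    rw [intervalIntegral.integral_comp_mul_sub _ hL.ne']
    simp only [mul_zero, mul_one, zero_sub, smul_eq_mul]
    congr 2; ring
  have sq : ∀ x, 0 < √(h x) := fun x => sqrt_pos.2 (hpos x)
  have sk : 0 < √(L / r) := sqrt_pos.2 (by positivity)
  have main := lsi1 (fun x => √(L / r) * √(h (L * x - L / 2)))
    (fun x => √(L / r) * (h' (L * x - L / 2) * L / (2 * √(h (L * x - L / 2)))))
    (by
      intro x
      have i1 : HasDerivAt (fun x => L * x - L / 2) L x := by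
        simpa using ((hasDerivAt_id x).const_mul L).sub_const (L/2)
      have i2 := (hh (L * x - L / 2)).comp x i1
      exact (i2.sqrt (hpos _).ne').const_mul _)
    (by
      have : ∀ x, 2 * √(h (L * x - L / 2)) ≠ 0 := fun x => by have := sq (L * x - L / 2); positivity
      fun_prop (disch := assumption))
    (by
      intro x
      have : L * (x + 1) - L / 2 = (L * x - L / 2) + L := by ring
      simp only [this, hp _])
    (fun x => mul_pos sk (sq _))
    (by
      have : ∀ x, (√(L / r) * √(h (L * x - L / 2))) ^ 2 = (L / r) * h (L * x - L / 2) := by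
        intro x
        rw [mul_pow, sq_sqrt (by positivity), sq_sqrt (hpos _).le]
      simp_rw [this]
      rw [intervalIntegral.integral_const_mul, cv, ← hr]
      field_simp)
  have e1 : ∀ x, (√(L / r) * √(h (L * x - L / 2))) ^ 2 * log (√(L / r) * √(h (L * x - L / 2)))
      = (fun y => (L / r) / 2 * (log (L / r) * h y + h y * log (h y))) (L * x - L / 2) := by
    intro x
    simp only
    rw [mul_pow, sq_sqrt (by positivity), sq_sqrt (hpos _).le, log_mul sk.ne' (sq _).ne',
      log_sqrt (by positivity), log_sqrt (hpos _).le]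
    ring
  have e2 : ∀ x, (√(L / r) * (h' (L * x - L / 2) * L / (2 * √(h (L * x - L / 2))))) ^ 2
      = (fun y => (L / r) * (L ^ 2 / 4) * (h' y ^ 2 / h y)) (L * x - L / 2) := by
    intro x
    simp only
    rw [mul_pow, sq_sqrt (by positivity), div_pow, mul_pow, mul_pow, sq_sqrt (hpos _).le]
    generalize h (L * x - L / 2) = a
    generalize h' (L * x - L / 2) = b
    rw [mul_div_mul_comm]
    ring
  rw [intervalIntegral.integral_congr (fun x _ => e1 x),
    intervalIntegral.integral_congr (fun x _ => e2 x)] at main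
  rw [cv (fun y => (L / r) / 2 * (log (L / r) * h y + h y * log (h y))),
    cv (fun y => (L / r) * (L ^ 2 / 4) * (h' y ^ 2 / h y)), intervalIntegral.integral_const_mul, intervalIntegral.integral_const_mul,
    intervalIntegral.integral_add, intervalIntegral.integral_const_mul, ← hr] at main
  rotate_left
  · exact (continuous_const.mul hc).intervalIntegrable _ _
  · exact (hc.mul (hc.log fun x => (hpos x).ne')).intervalIntegrable _ _
  rw [log_div hr0.ne' hL.ne']
  rw [log_div hL.ne' hr0.ne'] at main
  have := mul_le_mul_of_nonneg_left main (by positivity : 0 ≤ 2 * r)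
  set X := ∫ x in (-(L/2))..(L/2), h x * log (h x)
  set Y := ∫ x in (-(L/2))..(L/2), h' x ^ 2 / h x
  have l1 : 2 * r * (L⁻¹ * (L / r / 2 * ((log L - log r) * r + X))) = (log L - log r) * r + X := by
    field_simp
  have l2 : 2 * r * (1 / (2 * π ^ 2) * (L⁻¹ * (L / r * (L ^ 2 / 4) * Y)))
      = L ^ 2 / (4 * π ^ 2) * Y := by
    field_simp
  rw [l1, l2] at this
  linarith

lemma box_fubini {L : ℝ} (hL : 0 < L) {d : ℕ} (F : (Fin (d+1) → ℝ) → ℝ) (hF : Continuous F) :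
    ∫ x in box L (d+1), F x =
      ∫ y in box L d, ∫ t in (-(L/2))..(L/2), F (Fin.cons t y) := by
  set e : ℝ × (Fin d → ℝ) ≃ᵐ (Fin (d+1) → ℝ) :=
    (MeasurableEquiv.piFinSuccAbove (fun _ => ℝ) 0).symm with he
  have hem : MeasurePreserving e :=
    (volume_preserving_piFinSuccAbove (fun _ : Fin (d + 1) => ℝ) 0).symm _
  have heπ : (e ⁻¹' box L (d+1)) = Set.Icc (-(L/2)) (L/2) ×ˢ box L d :=
    ((Fin.insertNthOrderIso (fun _ => ℝ) 0).preimage_Icc _ _).trans (Set.Icc_prod_eq _ _)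
  have hee : ∀ p : ℝ × (Fin d → ℝ), e p = Fin.cons p.1 p.2 := by
    intro p
    simp [e, MeasurableEquiv.piFinSuccAbove_symm_apply, Fin.insertNthEquiv]
  have hc : Continuous fun p : ℝ × (Fin d → ℝ) => F (Fin.cons p.1 p.2) :=
    hF.comp (by fun_prop)
  rw [← hem.map_eq, setIntegral_map_equiv, heπ, Measure.volume_eq_prod]
  simp_rw [hee]
  rw [← Measure.prod_restrict, integral_prod_symm]
  · refine integral_congr_ae (ae_of_all _ fun y => ?_)
    simp only
    rw [intervalIntegral.integral_of_le (by linarith), integral_Icc_eq_integral_Ioc]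
  · rw [Measure.prod_restrict]
    exact hc.continuousOn.integrableOn_compact (isCompact_Icc.prod isCompact_Icc)

lemma int_box {L : ℝ} {d : ℕ} {F : (Fin d → ℝ) → ℝ} (hF : Continuous F) :
    IntegrableOn F (box L d) := hF.continuousOn.integrableOn_compact isCompact_Icc

lemma lsi_ind {L : ℝ} (hL : 0 < L) : ∀ (d : ℕ) (ρ : (Fin d → ℝ) → ℝ)
    (G : Fin d → (Fin d → ℝ) → ℝ), Continuous ρ → (∀ i, Continuous (G i)) →
    (∀ x i t, ρ (Function.update x i (t + L)) = ρ (Function.update x i t)) →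
    (∀ x, 0 < ρ x) →
    (∀ x i t, HasDerivAt (fun s => ρ (Function.update x i s)) (G i (Function.update x i t)) t) →
    ∫ x in box L d, ρ x * log (ρ x) ≤
      (∫ x in box L d, ρ x) * log ((∫ x in box L d, ρ x) / L ^ d) +
      L ^ 2 / (4 * π ^ 2) * ∫ x in box L d, (∑ i, G i x ^ 2) / ρ x := by
  intro d
  induction d with
  | zero =>
    intro ρ G _ _ _ _ _
    have hb : box L 0 = Set.univ := by
      ext x; simp [box, Set.mem_Icc]
    have hv : (volume : Measure (Fin 0 → ℝ)) = Measure.dirac 0 := by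
      rw [volume_pi, Measure.pi_of_empty _ 0]
    rw [hb, hv]
    simp
  | succ d ih =>
    intro ρ G hρ hG hper hpos hder
    have hcons : Continuous fun p : (Fin d → ℝ) × ℝ => (Fin.cons p.2 p.1 : Fin (d+1) → ℝ) := by
      fun_prop
    have cons1 : ∀ {F : (Fin (d+1) → ℝ) → ℝ}, Continuous F →
        ∀ y : Fin d → ℝ, Continuous fun t : ℝ => F (Fin.cons t y) :=
      fun hF y => hF.comp (by fun_prop)
    have parc : ∀ {F : (Fin (d+1) → ℝ) → ℝ}, Continuous F →
        Continuous fun y : Fin d → ℝ => ∫ t in (-(L/2))..(L/2), F (Fin.cons t y) := by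
      intro F hF
      exact intervalIntegral.continuous_parametric_intervalIntegral_of_continuous'
        (f := fun (y : Fin d → ℝ) (t : ℝ) => F (Fin.cons t y)) (hF.comp hcons) _ _
    set r : (Fin d → ℝ) → ℝ := fun y => ∫ t in (-(L/2))..(L/2), ρ (Fin.cons t y) with hr
    set Q : Fin d → (Fin d → ℝ) → ℝ :=
      fun i y => ∫ t in (-(L/2))..(L/2), G i.succ (Fin.cons t y) with hQ
    have hr0 : ∀ y, 0 < r y := fun y => intervalIntegral.intervalIntegral_pos_of_pos
      ((cons1 hρ y).intervalIntegrable _ _) (fun t => hpos _) (by linarith)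
    have hrc : Continuous r := parc hρ
    have hQc : ∀ i, Continuous (Q i) := fun i => parc (hG _)
    have hlog : Continuous fun x => log (ρ x) := hρ.log fun x => (hpos x).ne'
    have IH := ih r Q hrc hQc
      (by
        intro x i t
        simp only [hr, Fin.cons_update, hper])
      hr0
      (by
        intro x i t
        have hu : Continuous fun p : ℝ × ℝ =>
            G i.succ (Fin.cons p.2 (Function.update x i p.1)) :=
          (hG _).comp (by fun_prop)
        obtain ⟨C, hC⟩ := ((isCompact_Icc (a := t - 1) (b := t + 1)).prod
          (isCompact_Icc (a := -(L/2)) (b := L/2))).exists_bound_of_continuousOn hu.continuousOn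
        refine (intervalIntegral.hasDerivAt_integral_of_dominated_loc_of_deriv_le
          (F := fun s u => ρ (Fin.cons u (Function.update x i s)))
          (F' := fun s u => G i.succ (Fin.cons u (Function.update x i s)))
          (bound := fun _ => C) (s := Set.Icc (t - 1) (t + 1))
          (Icc_mem_nhds (by linarith) (by linarith)) ?_ ?_ ?_ ?_ ?_ ?_).2
        · exact Filter.Eventually.of_forall fun s => (cons1 hρ _).aestronglyMeasurable
        · exact (cons1 hρ _).intervalIntegrable _ _
        · exact (cons1 (hG _) _).aestronglyMeasurable
        · refine ae_of_all _ fun u hu s hs => hC (s, u) ⟨hs, ?_⟩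
          rw [Set.uIoc_of_le (by linarith)] at hu
          exact Set.Ioc_subset_Icc_self hu
        · exact intervalIntegrable_const
        · refine ae_of_all _ fun u _ s _ => ?_
          simp only [Fin.cons_update]
          exact hder _ _ _)
    -- one-dimensional inequality
    have one : ∀ y : Fin d → ℝ, ∫ t in (-(L/2))..(L/2), ρ (Fin.cons t y) * log (ρ (Fin.cons t y))
        ≤ r y * log (r y / L) + L ^ 2 / (4 * π ^ 2) *
          ∫ t in (-(L/2))..(L/2), G 0 (Fin.cons t y) ^ 2 / ρ (Fin.cons t y) := by
      intro y
      refine lsiL hL (fun t => ρ (Fin.cons t y)) (fun t => G 0 (Fin.cons t y)) ?_ (cons1 (hG 0) y)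
        ?_ (fun t => hpos _)
      · intro t
        have := hder (Fin.cons 0 y) 0 t
        simpa only [Fin.update_cons_zero] using this
      · intro t
        have := hper (Fin.cons 0 y) 0 t
        simpa only [Fin.update_cons_zero] using this
    -- Cauchy-Schwarz
    have cs : ∀ (i : Fin d) (y : Fin d → ℝ), Q i y ^ 2 / r y ≤
        ∫ t in (-(L/2))..(L/2), G i.succ (Fin.cons t y) ^ 2 / ρ (Fin.cons t y) := by
      intro i y
      set k := Q i y / r y with hk
      have c1 := cons1 (hG i.succ) y
      have c2 := cons1 hρ y
      have c3 : ∀ t : ℝ, ρ (Fin.cons t y) ≠ 0 := fun t => (hpos _).ne'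
      have : ∫ t in (-(L/2))..(L/2), (2 * k * G i.succ (Fin.cons t y) - k ^ 2 * ρ (Fin.cons t y))
          ≤ ∫ t in (-(L/2))..(L/2), G i.succ (Fin.cons t y) ^ 2 / ρ (Fin.cons t y) := by
        apply intervalIntegral.integral_mono_on (by linarith)
        · exact (Continuous.intervalIntegrable (by fun_prop) _ _)
        · exact (Continuous.intervalIntegrable ((c1.pow 2).div c2 c3) _ _)
        · intro t _
          rw [le_div_iff₀ (hpos _)]
          nlinarith [sq_nonneg (G i.succ (Fin.cons t y) - k * ρ (Fin.cons t y))]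
      rw [intervalIntegral.integral_sub (Continuous.intervalIntegrable (by fun_prop) _ _)
        (Continuous.intervalIntegrable (by fun_prop) _ _), intervalIntegral.integral_const_mul,
        intervalIntegral.integral_const_mul] at this
      have e : 2 * k * Q i y - k ^ 2 * r y = Q i y ^ 2 / r y := by
        rw [hk]; have := (hr0 y).ne'; field_simp; ring
      rw [← e]; exact this
    have hρ0 : ∀ x, ρ x ≠ 0 := fun x => (hpos x).ne'
    have hr0' : ∀ x, r x ≠ 0 := fun x => (hr0 x).ne'
    have cG : ∀ i, Continuous fun x => G i x ^ 2 / ρ x := fun i => ((hG i).pow 2).div hρ hρ0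
    have cG' : Continuous fun x => (∑ i, G i x ^ 2) / ρ x :=
      (continuous_finsetSum _ fun i _ => (hG i).pow 2).div hρ hρ0
    have cQ' : Continuous fun y => (∑ i, Q i y ^ 2) / r y :=
      (continuous_finsetSum _ fun i _ => (hQc i).pow 2).div hrc hr0'
    have crl : Continuous fun x => ρ x * log (ρ x) := hρ.mul hlog
    have clr : Continuous fun y => log (r y) := hrc.log hr0'
    have crr : Continuous fun y => r y * log (r y) := hrc.mul clr
    have cLr : Continuous fun y => log L * r y := continuous_const.mul hrc
    have cd0 : Continuous fun y => r y * log (r y) - log L * r y := crr.sub cLr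
    have ccG : Continuous fun y => L ^ 2 / (4 * π ^ 2) *
        ∫ t in (-(L/2))..(L/2), G 0 (Fin.cons t y) ^ 2 / ρ (Fin.cons t y) :=
      continuous_const.mul (parc (cG 0))
    rw [box_fubini hL _ hρ, box_fubini hL _ crl, box_fubini hL _ cG']
    set M := ∫ y in box L d, r y with hM
    set c := L ^ 2 / (4 * π ^ 2) with hcdef
    have hc0 : 0 ≤ c := by positivity
    -- integrate `one`
    have s1 : ∫ y in box L d, ∫ t in (-(L/2))..(L/2), ρ (Fin.cons t y) * log (ρ (Fin.cons t y))
        ≤ ∫ y in box L d, (r y * log (r y) - log L * r y + c *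
          ∫ t in (-(L/2))..(L/2), G 0 (Fin.cons t y) ^ 2 / ρ (Fin.cons t y)) := by
      apply setIntegral_mono (int_box (parc crl))
      · exact int_box (cd0.add ccG)
      · intro y
        have := one y
        rw [log_div (hr0' y) hL.ne'] at this
        simp only
        linarith
    rw [integral_add (int_box cd0) (int_box ccG),
      integral_sub (int_box crr) (int_box cLr),
      integral_const_mul, integral_const_mul, ← hM] at s1
    have s2 : (∫ y in box L d, ∫ t in (-(L/2))..(L/2), G 0 (Fin.cons t y) ^ 2 / ρ (Fin.cons t y))
        + ∫ y in box L d, (∑ i, Q i y ^ 2) / r y ≤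
        ∫ y in box L d, ∫ t in (-(L/2))..(L/2), (∑ i, G i (Fin.cons t y) ^ 2) / ρ (Fin.cons t y) := by
      rw [← integral_add (int_box (parc (cG 0))) (int_box cQ')]
      apply setIntegral_mono (int_box ((parc (cG 0)).add cQ')) (int_box (parc cG'))
      intro y
      simp only [Fin.sum_univ_succ, add_div, Finset.sum_div]
      rw [intervalIntegral.integral_add ((cons1 (cG 0) y).intervalIntegrable _ _)
        ((continuous_finsetSum _ fun i _ => cons1 (cG (Fin.succ i)) y).intervalIntegrable _ _),
        intervalIntegral.integral_finsetSum
          fun i _ => (cons1 (cG (Fin.succ i)) y).intervalIntegrable _ _]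
      exact add_le_add le_rfl (Finset.sum_le_sum fun i _ => cs i y)
    have s3 := mul_le_mul_of_nonneg_left s2 hc0
    have hM0 : 0 < M := by
      rw [hM, setIntegral_pos_iff_support_of_nonneg_ae (ae_of_all _ fun y => (hr0 y).le)
        (int_box hrc)]
      have : Function.support r = Set.univ := by
        ext y; simp [hr0' y]
      rw [this, Set.univ_inter, box, Real.volume_Icc_pi]
      rw [pos_iff_ne_zero, Finset.prod_ne_zero_iff]
      intro i _
      rw [← pos_iff_ne_zero, ENNReal.ofReal_pos]
      linarith
    have e : M * log (M / L ^ (d+1)) = M * log (M / L ^ d) - log L * M := by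
      rw [log_div hM0.ne' (by positivity), log_div hM0.ne' (by positivity), pow_succ,
        log_mul (by positivity) hL.ne']
      ring
    rw [e]
    linarith

/-- Log-Sobolev inequality on the flat torus: for a strictly positive `C¹` probability
density `ρ` on `U = [-L/2, L/2]^d`,
`H(ρ|ρ∞) ≤ (L²/(4π²)) ∫ |∇ log ρ|² ρ dx = (L²/(4π²)) ∫ |∇ρ|²/ρ dx`. -/
theorem log_sobolev_torus
    {d : ℕ} {L : ℝ} (hL : 0 < L)
    (ρ : (Fin d → ℝ) → ℝ) (hreg : ContDiff ℝ 1 ρ) (hper : Per L ρ)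
    (hpos : ∀ x, 0 < ρ x)
    (hprob : ∫ x in box L d, ρ x = 1) :
    relEnt L ρ ≤ L ^ 2 / (4 * π ^ 2) *
      ∫ x in box L d, (∑ i, (pd i ρ x) ^ 2) / ρ x := by
  have hc : Continuous ρ := hreg.continuous
  have hlog : Continuous fun x => log (ρ x) := hc.log fun x => (hpos x).ne'
  have main := lsi_ind hL d ρ (fun i => pd i ρ) hc
    (fun i => (hreg.continuous_fderiv one_ne_zero).clm_apply continuous_const)
    (by
      intro x i t
      rw [← hper (Function.update x i t) i]
      congr 1
      ext j
      by_cases hj : j = i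
      · subst hj; simp
      · simp [hj])
    hpos
    (by
      intro x i t
      exact ((hreg.differentiable one_ne_zero) _).hasFDerivAt.comp_hasDerivAt t
        (hasDerivAt_update x i t))
  rw [hprob] at main
  have e : relEnt L ρ = (∫ x in box L d, ρ x * log (ρ x)) + log (L ^ d) := by
    unfold relEnt
    have : ∀ x, ρ x * log (ρ x * L ^ d) = ρ x * log (ρ x) + log (L ^ d) * ρ x := by
      intro x
      rw [log_mul (hpos x).ne' (by positivity)]
      ring
    simp_rw [this]
    have c1 : Continuous fun x => ρ x * log (ρ x) := hc.mul hlog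
    have c2 : Continuous fun x => log (L ^ d) * ρ x := continuous_const.mul hc
    rw [integral_add (int_box c1) (int_box c2),
      integral_const_mul, hprob, mul_one]
  rw [e]
  rw [one_mul, one_div, log_inv] at main
  linarith
end
end
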